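/- (Optimal regularity, a priori estimate.) Let f ∈ C^{0,α}(B₁) and ψ ∈ C^{1,1}(B₁). There is a constant C > 0 depending only on n, α, ‖u‖_{L^∞(B₁)}, ‖f‖_{C^{0,α}(B₁)} and ‖ψ‖_{C^{1,1}(B₁)} such that: if u ∈ C^{1,1}(B₁) satisfies u ≤ ψ in B₁ and Δu = f·χ_{Ω(u)∩{u<ψ}} + Δψ·χ_{Ω(u)∩{u=ψ}} almost everywhere in B₁, then ‖D²u‖_{L^∞(B_{1/2})} ≤ C. -/

import Mathlib

/- Setting: the double obstacle problem
   Δu = f·χ_{Ω(u)∩{u<ψ}} + Δψ·χ_{Ω(u)∩{u=ψ}},  u ≤ ψ,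
   following "Regularity of the free boundary for the double obstacle problem". -/

open Set Metric MeasureTheory Filter
open scoped RealInnerProductSpace NNReal

noncomputable section

/-- Euclidean space `ℝⁿ`. -/
abbrev E (n : ℕ) := EuclideanSpace ℝ (Fin n)

variable {n : ℕ}

/-- Pointwise Laplacian, via iterated `fderiv` along the coordinate directions
(defined a.e. for `C^{1,1}` functions, junk value elsewhere). -/
def lap (u : E n → ℝ) (x : E n) : ℝ :=
  ∑ i : Fin n, fderiv ℝ (fun y => fderiv ℝ u y (EuclideanSpace.single i 1)) x
    (EuclideanSpace.single i 1)

/-- `Λ(v) = {x ∈ D : v(x) = 0, ∇v(x) = 0}`. -/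
def Lam (D : Set (E n)) (v : E n → ℝ) : Set (E n) :=
  {x ∈ D | v x = 0 ∧ gradient v x = 0}

/-- `Ω(v) = D \ Λ(v)`. -/
def Om (D : Set (E n)) (v : E n → ℝ) : Set (E n) := D \ Lam D v

/-- `Γ(v) = ∂Λ(v) ∩ D`. -/
def Gam (D : Set (E n)) (v : E n → ℝ) : Set (E n) := frontier (Lam D v) ∩ D

/-- `Λ^ψ(u) = {x ∈ D : u(x) = ψ(x)}`. -/
def LamPsi (D : Set (E n)) (u ψ : E n → ℝ) : Set (E n) := {x ∈ D | u x = ψ x}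

/-- `Γ^ψ(u) = ∂Λ^ψ(u) ∩ D`. -/
def GamPsi (D : Set (E n)) (u ψ : E n → ℝ) : Set (E n) := frontier (LamPsi D u ψ) ∩ D

/-- The unit ball `B₁`. -/
def B1 (n : ℕ) : Set (E n) := ball 0 1

/-- The class `P₁(M)`: `f ∈ C^{0,1}(B₁)`, `ψ ∈ C^{1,1}(B₁) ∩ C^{2,1}(closure Ω(ψ))`,
`u ∈ C^{1,1}(B₁)` with `‖D²u‖_{L^∞(B₁)} ≤ M`, `u ≤ ψ` in `B₁`,
`Δu = f·χ_{Ω(u)∩{u<ψ}} + Δψ·χ_{Ω(u)∩{u=ψ}}` a.e. in `B₁`, and `0 ∈ Γ^d(u)`. -/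
structure P1 (n : ℕ) (M : ℝ) (u ψ f : E n → ℝ) : Prop where
  f_lip : ∃ K : ℝ≥0, LipschitzOnWith K f (B1 n)
  psi_c1 : ContDiffOn ℝ 1 ψ (B1 n)
  psi_c11 : ∃ K : ℝ≥0, LipschitzOnWith K (fderiv ℝ ψ) (B1 n)
  psi_c2 : ContDiffOn ℝ 2 ψ (Om (B1 n) ψ)
  psi_c21 : ∃ K : ℝ≥0, LipschitzOnWith K (fderiv ℝ (fderiv ℝ ψ)) (closure (Om (B1 n) ψ))
  u_c1 : ContDiffOn ℝ 1 u (B1 n)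
  u_c11 : LipschitzOnWith (Real.toNNReal M) (fderiv ℝ u) (B1 n)
  u_le : ∀ x ∈ B1 n, u x ≤ ψ x
  u_eq : ∀ᵐ x : E n, x ∈ B1 n →
    lap u x = (Om (B1 n) u ∩ {y | u y < ψ y}).indicator f x
      + (Om (B1 n) u ∩ {y | u y = ψ y}).indicator (lap ψ) x
  zero_mem : (0 : E n) ∈ Gam (B1 n) u ∩ GamPsi (B1 n) u ψ

/-- Minimal diameter: least distance between two parallel hyperplanes whose
enclosed slab contains `A`. -/
def MD (A : Set (E n)) : ℝ :=
  sInf {d : ℝ | 0 ≤ d ∧ ∃ (e : E n) (b : ℝ), ‖e‖ = 1 ∧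
    ∀ x ∈ A, b ≤ ⟪x, e⟫ ∧ ⟪x, e⟫ ≤ b + d}

/-- Thickness `δ_r(v) = MD(Λ(v) ∩ B_r)/r` (centered at the origin). -/
def thick (D : Set (E n)) (v : E n → ℝ) (r : ℝ) : ℝ := MD (Lam D v ∩ ball (0 : E n) r) / r

open scoped ContDiff Topology

/-- coordinate vector -/
abbrev eb {d : ℕ} (i : Fin d) : E d := EuclideanSpace.single i (1:ℝ)

/-- partial derivative -/
def pd {d : ℕ} (i : Fin d) (w : E d → ℝ) (x : E d) : ℝ := fderiv ℝ w x (eb i)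

/-- test functions -/
structure TF {d : ℕ} (k : E d → ℝ) : Prop where
  smooth : ContDiff ℝ ∞ k
  cs : HasCompactSupport k

/-- kernels supported in the unit ball -/
structure Ker {d : ℕ} (k : E d → ℝ) : Prop where
  smooth : ContDiff ℝ ∞ k
  supp : tsupport k ⊆ ball 0 1

/-- scaling of kernels -/
def sc {d : ℕ} (r : ℝ) (k : E d → ℝ) (z : E d) : ℝ := (r ^ d)⁻¹ * k (r⁻¹ • z)

/-- convolution -/
def cv {d : ℕ} (k w : E d → ℝ) (x : E d) : ℝ := ∫ z, k (x - z) * w z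

theorem Ker.tf {d : ℕ} {k : E d → ℝ} (h : Ker k) : TF k :=
  ⟨h.smooth, Metric.isCompact_of_isClosed_isBounded (isClosed_tsupport k)
    (Metric.isBounded_ball.subset h.supp)⟩

theorem pd_smooth {d : ℕ} (i : Fin d) {k : E d → ℝ} (h : ContDiff ℝ ∞ k) :
    ContDiff ℝ ∞ (pd i k) :=
  (h.fderiv_right (m := ∞) (by simp)).clm_apply contDiff_const

theorem pd_tsupport {d : ℕ} (i : Fin d) (k : E d → ℝ) : tsupport (pd i k) ⊆ tsupport k :=
  tsupport_fderiv_apply_subset ℝ (eb i)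

theorem TF.pd {d : ℕ} {k : E d → ℝ} (h : TF k) (i : Fin d) : TF (pd i k) :=
  ⟨pd_smooth i h.smooth, h.cs.fderiv_apply ℝ (eb i)⟩

theorem Ker.pd {d : ℕ} {k : E d → ℝ} (h : Ker k) (i : Fin d) : Ker (pd i k) :=
  ⟨pd_smooth i h.smooth, (pd_tsupport i k).trans h.supp⟩

theorem Ker.zero_of_le {d : ℕ} {k : E d → ℝ} (h : Ker k) {z : E d} (hz : 1 ≤ ‖z‖) : k z = 0 := by
  by_contra hne
  have := h.supp (subset_tsupport k hne)
  simp at this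
  linarith

theorem TF.diff {d : ℕ} {k : E d → ℝ} (h : TF k) : Differentiable ℝ k :=
  h.smooth.differentiable (by simp)

theorem TF.cont {d : ℕ} {k : E d → ℝ} (h : TF k) : Continuous k := h.smooth.continuous

theorem TF.integrable {d : ℕ} {k : E d → ℝ} (h : TF k) : Integrable k :=
  h.cont.integrable_of_hasCompactSupport h.cs

theorem TF.bdd {d : ℕ} {k : E d → ℝ} (h : TF k) : ∃ C, 0 ≤ C ∧ ∀ z, |k z| ≤ C := by
  obtain ⟨C, hC⟩ := h.cont.bounded_above_of_compact_support h.cs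
  exact ⟨C, (norm_nonneg _).trans (hC 0), hC⟩

theorem pd_comm {d : ℕ} (i j : Fin d) {k : E d → ℝ} (h : ContDiff ℝ ∞ k) :
    pd i (pd j k) = pd j (pd i k) := by
  funext x
  have hs : IsSymmSndFDerivAt ℝ k x := h.contDiffAt.isSymmSndFDerivAt (by
    simp only [minSmoothness_of_isRCLikeNormedField]
    exact WithTop.coe_le_coe.2 le_top)
  have hd : DifferentiableAt ℝ (fderiv ℝ k) x :=
    ((h.fderiv_right (m := ∞) (by simp)).differentiable (by simp)) x
  have key : ∀ a b : Fin d, pd a (pd b k) x = fderiv ℝ (fderiv ℝ k) x (eb a) (eb b) := by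
    intro a b
    unfold pd
    rw [fderiv_clm_apply hd (by fun_prop)]
    simp
  rw [key, key]
  exact hs _ _

theorem pd_const_mul {d : ℕ} (i : Fin d) (c : ℝ) {k : E d → ℝ} (h : Differentiable ℝ k) :
    pd i (fun z => c * k z) = fun z => c * pd i k z := by
  funext x; unfold pd; rw [fderiv_const_mul (h x)]; simp

theorem pd_sub {d : ℕ} (i : Fin d) {k l : E d → ℝ} (h : Differentiable ℝ k)
    (h' : Differentiable ℝ l) :
    pd i (fun z => k z - l z) = fun z => pd i k z - pd i l z := by
  funext x; unfold pd; rw [fderiv_fun_sub (h x) (h' x)]; simp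

theorem pd_sum {d : ℕ} {ι : Type*} (s : Finset ι) (i : Fin d) {k : ι → E d → ℝ}
    (h : ∀ a ∈ s, Differentiable ℝ (k a)) :
    pd i (fun z => ∑ a ∈ s, k a z) = fun z => ∑ a ∈ s, pd i (k a) z := by
  funext x; unfold pd
  rw [fderiv_fun_sum (fun a ha => h a ha x)]; simp

theorem TF.const_mul {d : ℕ} {k : E d → ℝ} (h : TF k) (c : ℝ) : TF (fun z => c * k z) :=
  ⟨contDiff_const.mul h.smooth, h.cs.mul_left⟩

theorem TF.sum {d : ℕ} {ι : Type*} (s : Finset ι) {k : ι → E d → ℝ}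
    (h : ∀ a ∈ s, TF (k a)) : TF (fun z => ∑ a ∈ s, k a z) := by
  classical
  induction s using Finset.induction_on with
  | empty => exact ⟨by simpa using contDiff_const, by simp only [Finset.sum_empty]; exact (HasCompactSupport.zero : HasCompactSupport (0 : E d → ℝ))⟩
  | insert a s ha ih =>
    have h1 := h a (by simp)
    have h2 := ih (fun b hb => h b (by simp [hb]))
    simp only [Finset.sum_insert ha]
    exact ⟨h1.smooth.add h2.smooth, h1.cs.add h2.cs⟩

theorem pd_sc {d : ℕ} (i : Fin d) (r : ℝ) {k : E d → ℝ} (h : Differentiable ℝ k) :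
    pd i (sc r k) = fun z => r⁻¹ * sc r (pd i k) z := by
  have h2 : Differentiable ℝ (fun z : E d => k (r⁻¹ • z)) := h.comp (by fun_prop)
  funext x
  change pd i (fun z => (r^d)⁻¹ * k (r⁻¹ • z)) x = _
  rw [pd_const_mul i _ h2]
  unfold sc pd
  beta_reduce
  have : HasFDerivAt (fun z : E d => k (r⁻¹ • z))
      ((fderiv ℝ k (r⁻¹ • x)).comp (r⁻¹ • ContinuousLinearMap.id ℝ (E d))) x :=
    (h (r⁻¹ • x)).hasFDerivAt.comp x ((hasFDerivAt_id x).const_smul r⁻¹)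
  rw [this.fderiv]
  simp
  ring

theorem sc_tf {d : ℕ} {r : ℝ} (hr : 0 < r) {k : E d → ℝ} (h : TF k) : TF (sc r k) := by
  refine ⟨contDiff_const.mul (h.smooth.comp (by fun_prop)), ?_⟩
  have : HasCompactSupport (fun z : E d => k (r⁻¹ • z)) := h.cs.comp_smul (inv_ne_zero hr.ne')
  exact this.mul_left

theorem sc_zero {d : ℕ} {r : ℝ} (hr : 0 < r) {k : E d → ℝ} (h : Ker k) {z : E d} (hz : r ≤ ‖z‖) :
    sc r k z = 0 := by
  unfold sc
  rw [h.zero_of_le, mul_zero]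
  rw [norm_smul, norm_inv, Real.norm_of_nonneg hr.le, inv_mul_eq_div, one_le_div hr]
  exact hz

theorem abs_fderiv_le {d : ℕ} {w : E d → ℝ} {x : E d} : ‖fderiv ℝ w x‖ ≤ ∑ i, |pd i w x| := by
  refine ContinuousLinearMap.opNorm_le_bound _ (Finset.sum_nonneg fun i _ => abs_nonneg _) ?_
  intro y
  have hy : y = ∑ i, y i • eb i := by
    have := (EuclideanSpace.basisFun (Fin d) ℝ).sum_repr y
    simpa using this.symm
  conv_lhs => rw [hy]
  rw [map_sum, Finset.sum_mul]
  refine (norm_sum_le _ _).trans (Finset.sum_le_sum fun i _ => ?_)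
  rw [map_smul, norm_smul, mul_comm]
  exact mul_le_mul_of_nonneg_left (PiLp.norm_apply_le y i) (abs_nonneg _)

theorem eb_norm {d : ℕ} (i : Fin d) : ‖(eb i : E d)‖ = 1 := by simp

theorem abs_pd_le {d : ℕ} {w : E d → ℝ} {x : E d} (i : Fin d) : |pd i w x| ≤ ‖fderiv ℝ w x‖ := by
  have := (fderiv ℝ w x).le_opNorm (eb i)
  rwa [eb_norm, mul_one] at this


/-- cutoff profile -/
def chi (s : ℝ) : ℝ := Real.smoothTransition ((s - 1/16) * (16/3))

theorem chi_smooth : ContDiff ℝ ∞ chi :=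
  Real.smoothTransition.contDiff.comp (by fun_prop)

theorem chi_zero {s : ℝ} (h : s ≤ 1/16) : chi s = 0 :=
  Real.smoothTransition.zero_of_nonpos (by linarith)

theorem chi_one {s : ℝ} (h : 1/4 ≤ s) : chi s = 1 :=
  Real.smoothTransition.one_of_one_le (by linarith)

theorem chi_mono : Monotone chi := fun a b h =>
  Real.smoothTransition.monotone (by linarith)

theorem chi_deriv_smooth : ContDiff ℝ ∞ (deriv chi) :=
  (contDiff_infty_iff_deriv.1 chi_smooth).2

theorem chi_deriv_zero_left {s : ℝ} (h : s < 1/16) : deriv chi s = 0 := by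
  have : chi =ᶠ[𝓝 s] fun _ => 0 := by
    filter_upwards [Iio_mem_nhds h] with t ht using chi_zero (le_of_lt ht)
  rw [this.deriv_eq]; simp

theorem chi_deriv_zero_right {s : ℝ} (h : 1/4 < s) : deriv chi s = 0 := by
  have : chi =ᶠ[𝓝 s] fun _ => 1 := by
    filter_upwards [Ioi_mem_nhds h] with t ht using chi_one (le_of_lt ht)
  rw [this.deriv_eq]; simp

/-- flux profile -/
def mm (d : ℕ) (s : ℝ) : ℝ := s ^ (-(d:ℝ)/2) * (chi s - chi (4*s))

/-- density profile -/
def ph (d : ℕ) (s : ℝ) : ℝ := 2 * s * s ^ (-(d:ℝ)/2) * deriv chi s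

/-- primitive of the flux profile -/
def qq (d : ℕ) (s : ℝ) : ℝ := (1/2) * ∫ t in (1:ℝ)..s, mm d t

theorem mm_smooth (d : ℕ) : ContDiff ℝ ∞ (mm d) := by
  rw [contDiff_iff_contDiffAt]
  intro s
  by_cases hs : s < 1/64
  · have : mm d =ᶠ[𝓝 s] fun _ => 0 := by
      filter_upwards [Iio_mem_nhds hs] with t ht
      simp only [mem_Iio] at ht
      simp [mm, chi_zero (show t ≤ 1/16 by linarith), chi_zero (show 4*t ≤ 1/16 by linarith)]
    exact contDiffAt_const.congr_of_eventuallyEq this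
  · have hs' : s ≠ 0 := by intro h; rw [h] at hs; norm_num at hs
    refine (Real.contDiffAt_rpow_const_of_ne hs').mul ?_
    exact (chi_smooth.sub (chi_smooth.comp (by fun_prop))).contDiffAt

theorem ph_smooth (d : ℕ) : ContDiff ℝ ∞ (ph d) := by
  rw [contDiff_iff_contDiffAt]
  intro s
  by_cases hs : s < 1/16
  · have : ph d =ᶠ[𝓝 s] fun _ => 0 := by
      filter_upwards [Iio_mem_nhds hs] with t ht
      simp [ph, chi_deriv_zero_left ht]
    exact contDiffAt_const.congr_of_eventuallyEq this
  · have hs' : s ≠ 0 := by intro h; rw [h] at hs; norm_num at hs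
    refine ContDiffAt.mul (ContDiffAt.mul (by fun_prop) (Real.contDiffAt_rpow_const_of_ne hs')) ?_
    exact chi_deriv_smooth.contDiffAt

theorem mm_zero {d : ℕ} {s : ℝ} (h : 1/4 ≤ s) : mm d s = 0 := by
  simp [mm, chi_one h, chi_one (show 1/4 ≤ 4*s by linarith)]

theorem qq_deriv (d : ℕ) (s : ℝ) : HasDerivAt (qq d) ((1/2) * mm d s) s := by
  have hc := (mm_smooth d).continuous
  exact (intervalIntegral.integral_hasDerivAt_right (hc.intervalIntegrable _ _)
    hc.aestronglyMeasurable.stronglyMeasurableAtFilter hc.continuousAt).const_mul _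

theorem qq_smooth (d : ℕ) : ContDiff ℝ ∞ (qq d) := by
  rw [contDiff_infty_iff_deriv]
  refine ⟨fun s => (qq_deriv d s).differentiableAt, ?_⟩
  have : deriv (qq d) = fun s => (1/2) * mm d s := funext fun s => (qq_deriv d s).deriv
  rw [this]
  exact contDiff_const.mul (mm_smooth d)

theorem qq_zero {d : ℕ} {s : ℝ} (h : 1/4 ≤ s) : qq d s = 0 := by
  unfold qq
  rw [intervalIntegral.integral_congr (g := fun _ => 0)]
  · simp
  · intro t ht
    rw [mem_uIcc] at ht
    apply mm_zero
    rcases ht with ht | ht <;> linarith [ht.1, ht.2]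

theorem prof_id (d : ℕ) {s : ℝ} (hs : 0 ≤ s) :
    d * mm d s + 2 * s * deriv (mm d) s = ph d s - 2 ^ d * ph d (4 * s) := by
  rcases hs.eq_or_lt with rfl | hs
  · simp [mm, ph, chi_zero]
  have h4 : (4 * s) ^ (-(d:ℝ)/2) = (2 ^ d)⁻¹ * s ^ (-(d:ℝ)/2) := by
    rw [Real.mul_rpow (by norm_num) hs.le]
    congr 1
    rw [show (4:ℝ) = 2 ^ (2:ℝ) by norm_num, ← Real.rpow_mul (by norm_num)]
    rw [show (2:ℝ) * (-(d:ℝ)/2) = -(d:ℝ) by ring, Real.rpow_neg (by norm_num), Real.rpow_natCast]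
  have hc : ∀ t, HasDerivAt chi (deriv chi t) t := fun t =>
    ((chi_smooth.differentiable (by simp)) t).hasDerivAt
  have hc4 : HasDerivAt (fun t => chi (4 * t)) (deriv chi (4 * s) * 4) s := by
    have := (hc (4*s)).comp s ((hasDerivAt_id s).const_mul 4)
    simp only [mul_one] at this
    exact this
  have hP := Real.hasDerivAt_rpow_const (x := s) (p := -(d:ℝ)/2) (Or.inl hs.ne')
  have hm := hP.mul ((hc s).sub hc4)
  have hm' : deriv (mm d) s = _ := hm.deriv
  rw [hm', Real.rpow_sub_one hs.ne']
  unfold mm ph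
  rw [h4]
  field_simp
  simp only [Pi.sub_apply]
  ring

theorem radial_pd {d : ℕ} {q q' : ℝ → ℝ} (h : ∀ s, HasDerivAt q (q' s) s) (i : Fin d) :
    pd i (fun z : E d => q (‖z‖^2)) = fun z => 2 * q' (‖z‖^2) * z i := by
  funext z
  have h1 : HasFDerivAt (fun z : E d => ‖z‖^2) (2 • (innerSL ℝ z)) z :=
    (hasStrictFDerivAt_norm_sq z).hasFDerivAt
  have h2 := (h (‖z‖^2)).comp_hasFDerivAt z h1
  unfold pd
  change (fderiv ℝ (q ∘ fun z : E d => ‖z‖^2) z) _ = _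
  rw [h2.fderiv]
  simp [EuclideanSpace.inner_single_right]
  ring

theorem pd_coord {d : ℕ} (i : Fin d) (z : E d) : pd i (fun z : E d => z i) z = 1 := by
  unfold pd
  have : HasFDerivAt (fun z : E d => z i) (EuclideanSpace.proj i : E d →L[ℝ] ℝ) z :=
    (EuclideanSpace.proj i : E d →L[ℝ] ℝ).hasFDerivAt
  rw [this.fderiv]; simp

theorem radial_lap {d : ℕ} (z : E d) :
    ∑ i, pd i (pd i (fun z : E d => qq d (‖z‖^2))) z
      = d * mm d (‖z‖^2) + 2 * ‖z‖^2 * deriv (mm d) (‖z‖^2) := by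
  have h1 : ∀ i : Fin d, pd i (fun z : E d => qq d (‖z‖^2)) = fun z => mm d (‖z‖^2) * z i := by
    intro i
    rw [radial_pd (qq_deriv d)]
    funext z; ring
  have hm : ∀ s, HasDerivAt (mm d) (deriv (mm d) s) s := fun s =>
    (((mm_smooth d).differentiable (by simp)) s).hasDerivAt
  have h2 : ∀ i : Fin d, pd i (fun z : E d => mm d (‖z‖^2) * z i) z
      = 2 * deriv (mm d) (‖z‖^2) * (z i)^2 + mm d (‖z‖^2) := by
    intro i
    have hd1 : DifferentiableAt ℝ (fun z : E d => mm d (‖z‖^2)) z :=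
      (((mm_smooth d).differentiable (by simp)).comp (by
        exact (contDiff_norm_sq ℝ (n := 1)).differentiable (by simp))) z
    have hd2 : DifferentiableAt ℝ (fun z : E d => z i) z := 
      (EuclideanSpace.proj i : E d →L[ℝ] ℝ).differentiableAt
    have e1 := congrFun (radial_pd hm i) z
    have e2 := pd_coord i z
    unfold pd at e1 e2 ⊢
    rw [fderiv_fun_mul hd1 hd2]
    simp only [add_apply, smul_apply, smul_eq_mul, e1, e2]
    ring
  simp_rw [h1, h2, Finset.sum_add_distrib, ← Finset.mul_sum]
  rw [EuclideanSpace.real_norm_sq_eq]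
  simp
  ring

theorem ker_radial {d : ℕ} {q : ℝ → ℝ} (hq : ContDiff ℝ ∞ q) (h0 : ∀ s, 1/4 < s → q s = 0) :
    Ker (fun z : E d => q (‖z‖^2)) := by
  refine ⟨hq.comp (contDiff_norm_sq ℝ), ?_⟩
  have : tsupport (fun z : E d => q (‖z‖^2)) ⊆ closedBall 0 (1/2) := by
    refine closure_minimal ?_ isClosed_closedBall
    intro z hz
    by_contra hne
    simp at hne
    exact hz (h0 _ (by nlinarith))
  exact this.trans (closedBall_subset_ball (by norm_num))

theorem ph_nonneg (d : ℕ) {s : ℝ} (hs : 0 ≤ s) : 0 ≤ ph d s := by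
  have := chi_mono.deriv_nonneg (x := s)
  unfold ph
  positivity

theorem ph_ne (d : ℕ) : ∃ s, 0 < s ∧ ph d s ≠ 0 := by
  obtain ⟨c, hc, hd⟩ := exists_deriv_eq_slope chi (a := 1/16) (b := 1/4) (by norm_num)
    chi_smooth.continuous.continuousOn (chi_smooth.differentiable (by simp)).differentiableOn
  rw [chi_zero le_rfl, chi_one le_rfl] at hd
  have hc0 : 0 < c := by linarith [hc.1]
  refine ⟨c, hc0, ?_⟩
  unfold ph
  rw [hd]
  have := Real.rpow_pos_of_pos hc0 (-(d:ℝ)/2)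
  have h3 : (0:ℝ) < (1 - 0) / (1/4 - 1/16) := by norm_num
  positivity

theorem exists_kernels (d : ℕ) (i0 : Fin d) : ∃ φ Φ : E d → ℝ, Ker φ ∧ Ker Φ ∧ ∫ z, φ z = 1 ∧
    ∀ z, ∑ i, pd i (pd i Φ) z = φ z - sc (1/2) φ z := by
  have k1 : Ker (fun z : E d => ph d (‖z‖^2)) := ker_radial (ph_smooth d) (fun s hs => by
    simp [ph, chi_deriv_zero_right hs])
  have k2 : Ker (fun z : E d => qq d (‖z‖^2)) := ker_radial (qq_smooth d) (fun s hs =>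
    qq_zero hs.le)
  have hpos : 0 < ∫ z : E d, ph d (‖z‖^2) := by
    obtain ⟨s, hs, hne⟩ := ph_ne d
    refine k1.tf.cont.integral_pos_of_hasCompactSupport_nonneg_nonzero k1.tf.cs
      (fun z => ph_nonneg d (by positivity)) (x := Real.sqrt s • eb i0) ?_
    rw [norm_smul, eb_norm, mul_one, Real.norm_of_nonneg (Real.sqrt_nonneg s), Real.sq_sqrt hs.le]
    exact hne
  set c := ∫ z : E d, ph d (‖z‖^2) with hc
  have kc : ∀ {k : E d → ℝ}, Ker k → Ker (fun z => c⁻¹ * k z) := fun {k} h =>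
    ⟨contDiff_const.mul h.smooth, (tsupport_mul_subset_right).trans h.supp⟩
  refine ⟨fun z => c⁻¹ * ph d (‖z‖^2), fun z => c⁻¹ * qq d (‖z‖^2), kc k1, kc k2, ?_, ?_⟩
  · rw [integral_const_mul, ← hc, inv_mul_cancel₀ hpos.ne']
  · intro z
    have : ∀ i : Fin d, pd i (pd i (fun z : E d => c⁻¹ * qq d (‖z‖^2))) z
        = c⁻¹ * pd i (pd i (fun z : E d => qq d (‖z‖^2))) z := by
      intro i
      rw [pd_const_mul i _ k2.tf.diff, pd_const_mul i _ (k2.pd i).tf.diff]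
    simp_rw [this, ← Finset.mul_sum]
    rw [radial_lap, prof_id d (by positivity)]
    unfold sc
    beta_reduce
    have : ‖((1/2:ℝ))⁻¹ • z‖^2 = 4 * ‖z‖^2 := by
      rw [norm_smul]; norm_num; ring
    rw [this]
    simp
    ring


theorem cv_eq_conv {d : ℕ} (k w : E d → ℝ) :
    cv k w = convolution k w (ContinuousLinearMap.lsmul ℝ ℝ) volume := by
  funext x
  rw [convolution_lsmul_swap]
  rfl

theorem cv_integrable {d : ℕ} {k w : E d → ℝ} (hk : TF k) (hw : LocallyIntegrable w) (x : E d) :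
    Integrable (fun z => k (x - z) * w z) := by
  have h := hk.cs.convolutionExists_left (ContinuousLinearMap.lsmul ℝ ℝ) hk.cont hw x
  have h2 := h.integrable_swap
  simpa using h2

theorem cv_hasFDerivAt {d : ℕ} {k w : E d → ℝ} (hk : TF k) (hw : LocallyIntegrable w) (x : E d) :
    HasFDerivAt (cv k w) ((convolution (fderiv ℝ k) w
      ((ContinuousLinearMap.lsmul ℝ ℝ).precompL (E d)) volume) x) x := by
  rw [cv_eq_conv]
  exact hk.cs.hasFDerivAt_convolution_left (ContinuousLinearMap.lsmul ℝ ℝ)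
    (hk.smooth.of_le (by simp)) hw x

theorem cv_smooth {d : ℕ} {k w : E d → ℝ} (hk : TF k) (hw : LocallyIntegrable w) :
    ContDiff ℝ ∞ (cv k w) := by
  rw [cv_eq_conv]
  exact hk.cs.contDiff_convolution_left _ hk.smooth hw

theorem cv_pd {d : ℕ} {k w : E d → ℝ} (hk : TF k) (hw : LocallyIntegrable w) (i : Fin d) :
    pd i (cv k w) = cv (pd i k) w := by
  funext x
  have h := cv_hasFDerivAt hk hw x
  unfold pd
  rw [h.fderiv]
  have hcs : HasCompactSupport (fderiv ℝ k) := hk.cs.fderiv ℝ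
  have hce := hcs.convolutionExists_left ((ContinuousLinearMap.lsmul ℝ ℝ).precompL (E d))
    (hk.smooth.continuous_fderiv (by simp)) hw x
  have e1 : (convolution (fderiv ℝ k) w
      ((ContinuousLinearMap.lsmul ℝ ℝ).precompL (E d)) volume) x (eb i)
      = ∫ t, ((ContinuousLinearMap.lsmul ℝ ℝ).precompL (E d) (fderiv ℝ k t) (w (x - t))) (eb i) := by
    unfold convolution
    exact ContinuousLinearMap.integral_apply hce _
  rw [e1]
  have e2 := congrFun (cv_eq_conv (fun y => fderiv ℝ k y (eb i)) w) x
  rw [e2]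
  rfl

theorem cv_tf {d : ℕ} {k w : E d → ℝ} (hk : TF k) (hw : LocallyIntegrable w)
    (hc : HasCompactSupport w) : TF (cv k w) := by
  refine ⟨cv_smooth hk hw, ?_⟩
  rw [cv_eq_conv]
  exact HasCompactSupport.convolution _ hk.cs hc

theorem cv_sc {d : ℕ} {r : ℝ} (hr : 0 < r) (k w : E d → ℝ) (x : E d) :
    cv (sc r k) w x = ∫ y, k y * w (x - r • y) := by
  have h1 : cv (sc r k) w x = ∫ z, (r^d)⁻¹ * (k (r⁻¹ • z) * w (x - z)) := by
    unfold cv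
    rw [← integral_sub_left_eq_self _ volume x]
    congr 1; funext z
    simp [sc]; ring
  rw [h1, integral_const_mul]
  have h2 := Measure.integral_comp_smul (volume : Measure (E d))
    (fun z => k (r⁻¹ • z) * w (x - z)) r
  simp only [finrank_euclideanSpace, Fintype.card_fin, smul_eq_mul] at h2
  rw [abs_of_pos (by positivity)] at h2
  rw [← h2]
  congr 1; funext y
  rw [smul_smul, inv_mul_cancel₀ hr.ne', one_smul]

theorem cv_congr {d : ℕ} {r : ℝ} (hr : 0 < r) {k w w' : E d → ℝ} (hk : Ker k) {x : E d}
    (h : ∀ᵐ z, z ∈ ball x r → w z = w' z) : cv (sc r k) w x = cv (sc r k) w' x := by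
  unfold cv
  apply integral_congr_ae
  filter_upwards [h] with z hz
  by_cases hm : z ∈ ball x r
  · rw [hz hm]
  · rw [sc_zero hr hk, zero_mul, zero_mul]
    rw [mem_ball, dist_comm, dist_eq_norm] at hm
    linarith

theorem integral_abs_sc {d : ℕ} {r : ℝ} (hr : 0 < r) (k : E d → ℝ) (x : E d) :
    ∫ z, |sc r k (x - z)| = ∫ z, |k z| := by
  have := cv_sc hr (fun z => |k z|) (fun _ => 1) x
  simp only [mul_one] at this
  rw [← this]
  unfold cv sc
  congr 1; funext z
  rw [abs_mul, abs_of_pos (by positivity : 0 < (r^d)⁻¹), mul_one]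

theorem sc_abs_integrable {d : ℕ} {r : ℝ} (hr : 0 < r) {k : E d → ℝ} (hk : TF k) (x : E d) :
    Integrable (fun z => |sc r k (x - z)|) :=
  ((sc_tf hr hk).integrable.comp_sub_left x).abs

theorem cv_bound {d : ℕ} {r M : ℝ} (hr : 0 < r) {k w : E d → ℝ} (hk : Ker k) {x : E d}
    (h : ∀ᵐ z, z ∈ ball x r → |w z| ≤ M) : |cv (sc r k) w x| ≤ (∫ z, |k z|) * M := by
  rw [← integral_abs_sc hr k x, ← integral_mul_const]
  unfold cv
  rw [← Real.norm_eq_abs (∫ z, sc r k (x - z) * w z)]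
  refine norm_integral_le_of_norm_le ((sc_abs_integrable hr hk.tf x).mul_const M) ?_
  filter_upwards [h] with z hz
  by_cases hm : z ∈ ball x r
  · rw [Real.norm_eq_abs, abs_mul]
    exact mul_le_mul_of_nonneg_left (hz hm) (abs_nonneg _)
  · rw [sc_zero hr hk]
    · simp
    · rw [mem_ball, dist_comm, dist_eq_norm] at hm
      linarith

theorem pd_comp_sub {d : ℕ} {k : E d → ℝ} (hk : Differentiable ℝ k) (i : Fin d) (x z : E d) :
    pd i (fun z => k (x - z)) z = - pd i k (x - z) := by
  unfold pd
  have : HasFDerivAt (fun z => k (x - z)) ((fderiv ℝ k (x - z)).comp (-ContinuousLinearMap.id ℝ _)) z :=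
    (hk (x - z)).hasFDerivAt.comp z ((hasFDerivAt_id z).const_sub x)
  rw [this.fderiv]; simp

theorem lip_pd_bound {d : ℕ} {w : E d → ℝ} {L : ℝ≥0} (hw : LipschitzWith L w) (i : Fin d) (z : E d) :
    |pd i w z| ≤ L := by
  exact (abs_pd_le i).trans (norm_fderiv_le_of_lipschitz ℝ hw)

theorem pd_meas {d : ℕ} (w : E d → ℝ) (i : Fin d) : Measurable (pd i w) :=
  measurable_fderiv_apply_const ℝ w (eb i)

theorem locInt_of_bdd {d : ℕ} {w : E d → ℝ} (hm : AEStronglyMeasurable w) {C : ℝ}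
    (h : ∀ᵐ z, |w z| ≤ C) : LocallyIntegrable w := by
  refine MemLp.locallyIntegrable (p := ⊤) ?_ (by simp)
  exact memLp_top_of_bound hm C h

theorem pd_locInt {d : ℕ} {w : E d → ℝ} {L : ℝ≥0} (hw : LipschitzWith L w) (i : Fin d) :
    LocallyIntegrable (pd i w) :=
  locInt_of_bdd (pd_meas w i).aestronglyMeasurable (Eventually.of_forall (lip_pd_bound hw i))

theorem cv_ibp {d : ℕ} {k w : E d → ℝ} (hk : TF k) {L : ℝ≥0} (hw : LipschitzWith L w) (i : Fin d)
    (x : E d) : cv (pd i k) w x = cv k (pd i w) x := by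
  have hk' : TF (fun z => k (x - z)) := by
    refine ⟨hk.smooth.comp (by fun_prop), ?_⟩
    exact hk.cs.comp_homeomorph (Homeomorph.subLeft x)
  obtain ⟨D, hD⟩ : ∃ D, LipschitzWith D (fun z => k (x - z)) :=
    ContDiff.lipschitzWith_of_hasCompactSupport hk'.cs hk'.smooth (by simp)
  have h := LipschitzWith.integral_lineDeriv_mul_eq (μ := volume) hw hD hk'.cs (eb i)
  unfold cv
  have e1 : ∫ z, lineDeriv ℝ w z (eb i) * k (x - z) = ∫ z, k (x - z) * pd i w z := by
    apply integral_congr_ae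
    filter_upwards [hw.ae_differentiableAt] with z hz
    rw [hz.lineDeriv_eq_fderiv, mul_comm]; rfl
  have e2 : ∀ z, lineDeriv ℝ (fun z => k (x - z)) z (-eb i) = pd i k (x - z) := by
    intro z
    rw [(hk'.diff z).lineDeriv_eq_fderiv, map_neg]
    have := pd_comp_sub hk.diff i x z
    unfold pd at this ⊢
    rw [this]; simp
  rw [e1] at h
  simp_rw [e2] at h
  exact h.symm

theorem cv_lip_limit {d : ℕ} {r : ℝ} (hr : 0 < r) {k w : E d → ℝ} (hk : Ker k) (h1 : ∫ z, k z = 1)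
    {L : ℝ≥0} (hw : LipschitzWith L w) (x : E d) :
    |cv (sc r k) w x - w x| ≤ (∫ z, |k z|) * (L * r) := by
  have e : cv (sc r k) w x - w x = cv (sc r k) (fun z => w z - w x) x := by
    rw [cv_sc hr, cv_sc hr]
    have i1 : Integrable (fun y => k y * w (x - r • y)) := by
      apply Continuous.integrable_of_hasCompactSupport
      · exact hk.tf.cont.mul (hw.continuous.comp (by fun_prop))
      · exact hk.tf.cs.mul_right
    simp_rw [mul_sub]
    rw [integral_sub i1 (hk.tf.integrable.mul_const _), integral_mul_const, h1, one_mul]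
  rw [e]
  apply cv_bound hr hk
  refine Eventually.of_forall fun z hz => ?_
  have := hw.dist_le_mul z x
  rw [Real.dist_eq] at this
  refine this.trans (mul_le_mul_of_nonneg_left (le_of_lt hz) L.2)


theorem TF.mul_int {d : ℕ} {f g : E d → ℝ} (hf : TF f) (hg : TF g) :
    Integrable (fun z => f z * g z) :=
  (hf.cont.mul hg.cont).integrable_of_hasCompactSupport hf.cs.mul_right

theorem tf_ibp {d : ℕ} {f g : E d → ℝ} (hf : TF f) (hg : TF g) (i : Fin d) :
    ∫ z, f z * pd i g z = - ∫ z, pd i f z * g z :=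
  integral_mul_fderiv_eq_neg_fderiv_mul_of_integrable ((hf.pd i).mul_int hg)
    (hf.mul_int (hg.pd i)) (hf.mul_int hg) (fun z _ => hf.diff z) (fun z _ => hg.diff z)

theorem energy_aux {d : ℕ} {W : E d → ℝ} (hW : TF W) (i j : Fin d) :
    ∫ z, (pd i (pd j W) z)^2 = ∫ z, pd i (pd i W) z * pd j (pd j W) z := by
  have h1 : ∫ z, (pd i (pd j W) z)^2 = ∫ z, pd i (pd j W) z * pd j (pd i W) z := by
    rw [pd_comm j i hW.smooth]; congr 1; funext z; ring
  rw [h1, tf_ibp ((hW.pd j).pd i) (hW.pd i) j, pd_comm j i (hW.pd j).smooth]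
  have h2 : ∫ z, pd i (pd j (pd j W)) z * pd i W z = ∫ z, pd i W z * pd i (pd j (pd j W)) z := by
    congr 1; funext z; ring
  rw [h2, tf_ibp (hW.pd i) ((hW.pd j).pd j) i, neg_neg]

theorem energy {d : ℕ} {W : E d → ℝ} (hW : TF W) (i j : Fin d) :
    ∫ z, (pd i (pd j W) z)^2 ≤ ∫ z, (∑ l, pd l (pd l W) z)^2 := by
  have h1 : ∫ z, (∑ l, pd l (pd l W) z)^2 = ∑ a, ∑ b, ∫ z, (pd a (pd b W) z)^2 := by
    simp_rw [energy_aux hW, sq, Finset.sum_mul_sum]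
    rw [integral_finsetSum _ fun a _ => integrable_finsetSum _ fun b _ =>
      ((hW.pd a).pd a).mul_int ((hW.pd b).pd b)]
    refine Finset.sum_congr rfl fun a _ => ?_
    rw [integral_finsetSum _ fun b _ => ((hW.pd a).pd a).mul_int ((hW.pd b).pd b)]
  rw [h1]
  have hn : ∀ a b : Fin d, 0 ≤ ∫ z, (pd a (pd b W) z)^2 := fun a b =>
    integral_nonneg fun z => sq_nonneg _
  calc _ ≤ ∑ b, ∫ z, (pd i (pd b W) z)^2 :=
        Finset.single_le_sum (f := fun b => ∫ z, (pd i (pd b W) z)^2) (fun b _ => hn i b)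
          (Finset.mem_univ j)
    _ ≤ _ := Finset.single_le_sum (f := fun a => ∑ b, ∫ z, (pd a (pd b W) z)^2)
          (fun a _ => Finset.sum_nonneg fun b _ => hn a b) (Finset.mem_univ i)

theorem pd2_sc {d : ℕ} (a b : Fin d) {r : ℝ} (hr : 0 < r) {Φ : E d → ℝ} (h : TF Φ) :
    pd a (pd b (fun z => r^2 * sc r Φ z)) = sc r (pd a (pd b Φ)) := by
  rw [pd_const_mul b _ (sc_tf hr h).diff, pd_sc b r h.diff]
  have : (fun z => r^2 * (r⁻¹ * sc r (pd b Φ) z)) = fun z => r * sc r (pd b Φ) z := by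
    funext z; field_simp
  rw [this, pd_const_mul a _ (sc_tf hr (h.pd b)).diff, pd_sc a r (h.pd b).diff]
  funext z; field_simp

theorem sc_sc_half {d : ℕ} (r : ℝ) (φ : E d → ℝ) :
    sc r (sc (1/2) φ) = sc (r/2) φ := by
  funext z
  unfold sc
  rw [smul_smul, ← mul_assoc, ← mul_inv, ← mul_pow]
  congr 3
  · ring
  · rw [← mul_inv]; ring

theorem sc_lap {d : ℕ} {r : ℝ} {φ Φ : E d → ℝ}
    (hlap : ∀ z, ∑ i, pd i (pd i Φ) z = φ z - sc (1/2) φ z) (z : E d) :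
    ∑ l, sc r (pd l (pd l Φ)) z = sc r φ z - sc (r/2) φ z := by
  rw [← sc_sc_half]
  unfold sc
  rw [← Finset.mul_sum, hlap, mul_sub]
  rfl

theorem cv_sq {d : ℕ} {k h : E d → ℝ} (hk : TF k) {H V : ℝ} (hH : 0 ≤ H)
    (hi : Integrable h) (hb : ∀ᵐ z, |h z| ≤ H) (hV : ∫ z, |h z| ≤ H * V) :
    ∫ x, (cv k h x)^2 ≤ (∫ z, |k z|)^2 * H^2 * V := by
  set A := ∫ z, |k z| with hA
  have hA0 : 0 ≤ A := integral_nonneg fun z => abs_nonneg _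
  have hcomp : ∀ x, Integrable (fun z => |k (x - z)|) := fun x =>
    (hk.integrable.comp_sub_left x).abs
  have h1 : ∀ x, |cv k h x| ≤ A * H := by
    intro x
    have : A = ∫ z, |k (x - z)| := by
      rw [hA, ← integral_sub_left_eq_self _ volume x]
    rw [this, ← integral_mul_const, ← Real.norm_eq_abs (cv k h x)]
    refine norm_integral_le_of_norm_le ((hcomp x).mul_const H) ?_
    filter_upwards [hb] with z hz
    rw [Real.norm_eq_abs, abs_mul]
    exact mul_le_mul_of_nonneg_left hz (abs_nonneg _)
  have h2 : ∀ x, |cv k h x| ≤ cv (fun z => |k z|) (fun z => |h z|) x := by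
    intro x
    unfold cv
    rw [← Real.norm_eq_abs (∫ z, k (x - z) * h z)]
    refine (norm_integral_le_integral_norm _).trans (le_of_eq ?_)
    congr 1; funext z; rw [Real.norm_eq_abs, abs_mul]
  have hI : Integrable (cv (fun z => |k z|) (fun z => |h z|)) := by
    rw [cv_eq_conv]
    exact hk.integrable.abs.integrable_convolution _ hi.abs
  have hII : ∫ x, cv (fun z => |k z|) (fun z => |h z|) x = A * ∫ z, |h z| := by
    rw [cv_eq_conv, integral_convolution _ hk.integrable.abs hi.abs]
    rfl
  calc ∫ x, (cv k h x)^2 ≤ ∫ x, A * H * cv (fun z => |k z|) (fun z => |h z|) x := by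
        refine integral_mono_of_nonneg (Eventually.of_forall fun x => sq_nonneg _)
          (hI.const_mul _) (Eventually.of_forall fun x => ?_)
        change (cv k h x)^2 ≤ _
        rw [← sq_abs, sq]
        exact mul_le_mul (h1 x) (h2 x) (abs_nonneg _) (by positivity)
    _ = A * H * (A * ∫ z, |h z|) := by rw [integral_const_mul, hII]
    _ ≤ A * H * (A * (H * V)) := by gcongr
    _ = _ := by ring

/-- dyadic radii -/
def rr (j : ℕ) : ℝ := (1/2)^(j+3)

theorem rr_pos (j : ℕ) : 0 < rr j := by unfold rr; positivity
theorem rr_succ (j : ℕ) : rr (j+1) = rr j / 2 := by unfold rr; ring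
theorem rr_le (j : ℕ) : rr j ≤ 1/8 := by
  unfold rr
  rw [pow_add]
  have : ((1:ℝ)/2)^j ≤ 1 := pow_le_one₀ (by norm_num) (by norm_num)
  linarith [show ((1:ℝ)/2)^3 = 1/8 by norm_num]
theorem rr_anti : Antitone rr := antitone_nat_of_succ_le fun j => by
  rw [rr_succ]; linarith [rr_pos j]
theorem rr_tendsto : Tendsto rr atTop (𝓝 0) := by
  have := (tendsto_pow_atTop_nhds_zero_of_lt_one (r := (1/2:ℝ)) (by norm_num) (by norm_num))
  exact this.comp (tendsto_add_atTop_nat 3)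

theorem L2_bound {d : ℕ} {φ Φ : E d → ℝ} (hφ : Ker φ) (hΦ : Ker Φ)
    (hlap : ∀ z, ∑ i, pd i (pd i Φ) z = φ z - sc (1/2) φ z) (a b : Fin d)
    {h : E d → ℝ} {H V : ℝ} (hH : 0 ≤ H) (hi : Integrable h) (hcs : HasCompactSupport h)
    (hb : ∀ᵐ z, |h z| ≤ H) (hV : ∫ z, |h z| ≤ H * V) (k m : ℕ) (hkm : k ≤ m) :
    Integrable (fun x => (∑ j ∈ Finset.Ico k m, cv (sc (rr j) (pd a (pd b Φ))) h x)^2) ∧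
    ∫ x, (∑ j ∈ Finset.Ico k m, cv (sc (rr j) (pd a (pd b Φ))) h x)^2
      ≤ 4 * (∫ z, |φ z|)^2 * H^2 * V := by
  have hl := hi.locallyIntegrable
  set W : E d → ℝ := fun x => ∑ j ∈ Finset.Ico k m, cv (fun z => (rr j)^2 * sc (rr j) Φ z) h x with hWdef
  have ht : ∀ j, TF (fun z => (rr j)^2 * sc (rr j) Φ z) := fun j =>
    (sc_tf (rr_pos j) hΦ.tf).const_mul _
  have hW : TF W := TF.sum _ fun j _ => cv_tf (ht j) hl hcs
  have hpd : ∀ a b : Fin d, pd a (pd b W) = fun x => ∑ j ∈ Finset.Ico k m, cv (sc (rr j) (pd a (pd b Φ))) h x := by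
    intro a b
    rw [hWdef, pd_sum _ b (fun j _ => (cv_tf (ht j) hl hcs).diff)]
    rw [pd_sum _ a (fun j _ => ((cv_tf (ht j) hl hcs).pd b).diff)]
    funext x
    refine Finset.sum_congr rfl fun j _ => ?_
    rw [cv_pd (ht j) hl, cv_pd ((ht j).pd b) hl, pd2_sc a b (rr_pos j) hΦ.tf]
  have hlapW : ∀ x, ∑ l, pd l (pd l W) x = cv (sc (rr k) φ) h x - cv (sc (rr m) φ) h x := by
    intro x
    simp_rw [hpd]
    rw [Finset.sum_comm]
    have : ∀ j, ∑ l, cv (sc (rr j) (pd l (pd l Φ))) h x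
        = -(cv (sc (rr (j+1)) φ) h x) - (-(cv (sc (rr j) φ) h x)) := by
      intro j
      unfold cv
      rw [← integral_finsetSum _ fun l _ => cv_integrable (sc_tf (rr_pos j) ((hΦ.tf.pd l).pd l)) hl x]
      simp_rw [← Finset.sum_mul, sc_lap hlap, sub_mul]
      rw [integral_sub (cv_integrable (sc_tf (rr_pos j) hφ.tf) hl x)]
      · rw [rr_succ]; ring
      · rw [← rr_succ]; exact cv_integrable (sc_tf (rr_pos _) hφ.tf) hl x
    simp_rw [this]
    rw [Finset.sum_Ico_sub (fun j => -(cv (sc (rr j) φ) h x)) hkm]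
    ring
  have hab := congrFun (hpd a b)
  simp_rw [← hab]
  refine ⟨by simpa [sq] using ((hW.pd b).pd a).mul_int ((hW.pd b).pd a), (energy hW a b).trans ?_⟩
  simp_rw [hlapW]
  have hsq : ∀ j, Integrable (fun x => (cv (sc (rr j) φ) h x)^2) := fun j => by
    have := cv_tf (sc_tf (rr_pos j) hφ.tf) hl hcs
    simpa [sq] using this.mul_int this
  have hone : ∀ j, ∫ x, (cv (sc (rr j) φ) h x)^2 ≤ (∫ z, |φ z|)^2 * H^2 * V := by
    intro j
    have := cv_sq (sc_tf (rr_pos j) hφ.tf) hH hi hb hV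
    have e : ∫ z, |sc (rr j) φ z| = ∫ z, |φ z| := by
      rw [← integral_abs_sc (rr_pos j) φ 0, ← integral_sub_left_eq_self _ volume 0]
    rwa [e] at this
  calc _ ≤ ∫ x, (2 * (cv (sc (rr k) φ) h x)^2 + 2 * (cv (sc (rr m) φ) h x)^2) := by
        refine integral_mono_of_nonneg (Eventually.of_forall fun x => sq_nonneg _)
          (((hsq k).const_mul 2).add ((hsq m).const_mul 2)) (Eventually.of_forall fun x => ?_)
        change (cv (sc (rr k) φ) h x - cv (sc (rr m) φ) h x)^2 ≤ _
        nlinarith [sq_nonneg (cv (sc (rr k) φ) h x + cv (sc (rr m) φ) h x)]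
    _ = 2 * (∫ x, (cv (sc (rr k) φ) h x)^2) + 2 * ∫ x, (cv (sc (rr m) φ) h x)^2 := by
        rw [integral_add ((hsq k).const_mul 2) ((hsq m).const_mul 2), integral_const_mul,
          integral_const_mul]
    _ ≤ _ := by linarith [hone k, hone m]


/-- divergence of the gradient field -/
def gg {d : ℕ} (v : Fin d → E d → ℝ) (x : E d) : ℝ := ∑ l, pd l (v l) x

/-- the data of the problem, globally extended -/
structure Dat {d : ℕ} (u : E d → ℝ) (v : Fin d → E d → ℝ) (f : E d → ℝ) (Z : Set (E d))
    (α K G : ℝ) : Prop where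
  uLip : ∃ L, LipschitzWith L u
  vLip : ∃ L, ∀ j, LipschitzWith L (v j)
  grad : ∀ x ∈ ball (0 : E d) 1, ∀ j, pd j u x = v j x
  ub : ∀ x ∈ ball (0 : E d) 1, |u x| ≤ K
  fm : AEStronglyMeasurable f
  fb : ∀ x, |f x| ≤ K
  fH : ∀ x ∈ ball (0 : E d) 1, ∀ y ∈ ball (0 : E d) 1, |f x - f y| ≤ K * ‖x - y‖ ^ α
  Zm : MeasurableSet Z
  geq : ∀ᵐ x, x ∈ ball (0 : E d) 1 → x ∉ Z → gg v x = f x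
  gb : ∀ᵐ x, x ∈ ball (0 : E d) 1 → |gg v x| ≤ G
  Zb : ∀ᵐ x, x ∈ ball (0 : E d) 1 → x ∈ Z → ∀ i j, |pd i (v j) x| ≤ K

/-- mollified second derivatives -/
def AA {d : ℕ} (φ : E d → ℝ) (a b : Fin d) (u : E d → ℝ) (k : ℕ) (x : E d) : ℝ :=
  cv (pd a (pd b (sc (rr k) φ))) u x

theorem cv_congr' {d : ℕ} {r : ℝ} {k w w' : E d → ℝ} (hk : ∀ z, r ≤ ‖z‖ → k z = 0) {x : E d}
    (h : ∀ᵐ z, z ∈ ball x r → w z = w' z) : cv k w x = cv k w' x := by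
  unfold cv
  apply integral_congr_ae
  filter_upwards [h] with z hz
  by_cases hm : z ∈ ball x r
  · rw [hz hm]
  · rw [hk, zero_mul, zero_mul]
    rw [mem_ball, dist_comm, dist_eq_norm] at hm
    linarith

theorem sub_unit_ball {d : ℕ} {x : E d} (hx : ‖x‖ ≤ 3/4) (k : ℕ) {z : E d} (hz : z ∈ ball x (rr k)) :
    z ∈ ball (0 : E d) 1 := by
  rw [mem_ball, dist_eq_norm] at hz
  rw [mem_ball_zero_iff]
  have := norm_le_norm_add_norm_sub' z x
  linarith [rr_le k]

theorem pd4_comm {d : ℕ} {Ψ : E d → ℝ} (h : ContDiff ℝ ∞ Ψ) (a b l : Fin d) :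
    pd a (pd b (pd l (pd l Ψ))) = pd l (pd l (pd a (pd b Ψ))) := by
  rw [pd_comm b l (pd_smooth l h), pd_comm b l h, pd_comm a l (pd_smooth l (pd_smooth b h)),
    pd_comm a l (pd_smooth b h)]

theorem pd_sc_zero {d : ℕ} {r : ℝ} (hr : 0 < r) {k : E d → ℝ} (h : Ker k) (l : Fin d) (z : E d)
    (hz : r ≤ ‖z‖) : pd l (sc r k) z = 0 := by
  rw [pd_sc l r h.tf.diff]
  beta_reduce
  rw [sc_zero hr (h.pd l) hz, mul_zero]

theorem tf_ibp_one {d : ℕ} {k : E d → ℝ} (hk : TF k) (i : Fin d) : ∫ z, pd i k z = 0 := by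
  have h := cv_ibp hk (LipschitzWith.const (1:ℝ)) i 0
  have hz : ∀ z, pd i (fun _ : E d => (1:ℝ)) z = 0 := by intro z; simp [pd]
  unfold cv at h
  simp_rw [hz] at h
  rw [← integral_sub_left_eq_self _ volume 0]
  simpa using h

theorem Dat.uLoc {d : ℕ} {u : E d → ℝ} {v : Fin d → E d → ℝ} {f : E d → ℝ} {Z : Set (E d)}
    {α K G : ℝ} (D : Dat u v f Z α K G) : LocallyIntegrable u := by
  obtain ⟨L, hL⟩ := D.uLip
  exact hL.continuous.locallyIntegrable

theorem gg_meas {d : ℕ} (v : Fin d → E d → ℝ) : Measurable (gg v) :=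
  Finset.measurable_fun_sum _ fun l _ => pd_meas (v l) l

theorem Dat.gLoc {d : ℕ} {u : E d → ℝ} {v : Fin d → E d → ℝ} {f : E d → ℝ} {Z : Set (E d)}
    {α K G : ℝ} (D : Dat u v f Z α K G) : LocallyIntegrable (gg v) := by
  obtain ⟨L, hL⟩ := D.vLip
  refine locInt_of_bdd (C := ∑ _l : Fin d, (L:ℝ)) (gg_meas v).aestronglyMeasurable
    (Eventually.of_forall fun z => ?_)
  exact (Finset.abs_sum_le_sum_abs _ _).trans (Finset.sum_le_sum fun l _ => lip_pd_bound (hL l) l z)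

theorem lap_kernel {d : ℕ} {φ Φ : E d → ℝ} (hφ : Ker φ) (hΦ : Ker Φ)
    (hlap : ∀ z, ∑ i, pd i (pd i Φ) z = φ z - sc (1/2) φ z) (a b : Fin d) {r : ℝ} (hr : 0 < r)
    (z : E d) :
    pd a (pd b (sc r φ)) z - pd a (pd b (sc (r/2) φ)) z
      = ∑ l, pd l (pd l (sc r (pd a (pd b Φ)))) z := by
  have hr2 : 0 < r / 2 := by linarith
  set Ψ : E d → ℝ := fun z => r^2 * sc r Φ z with hΨ
  have tΨ : TF Ψ := (sc_tf hr hΦ.tf).const_mul _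
  have e1 : (fun z => sc r φ z - sc (r/2) φ z) = fun z => ∑ l, pd l (pd l Ψ) z := by
    funext z
    rw [← sc_lap hlap]
    refine Finset.sum_congr rfl fun l _ => ?_
    rw [hΨ, pd2_sc l l hr hΦ.tf]
  have e2 : pd a (pd b (fun z => sc r φ z - sc (r/2) φ z)) =
      fun z => pd a (pd b (sc r φ)) z - pd a (pd b (sc (r/2) φ)) z := by
    rw [pd_sub b (sc_tf hr hφ.tf).diff (sc_tf hr2 hφ.tf).diff,
      pd_sub a ((sc_tf hr hφ.tf).pd b).diff ((sc_tf hr2 hφ.tf).pd b).diff]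
  have e3 : pd a (pd b (fun z => ∑ l, pd l (pd l Ψ) z)) =
      fun z => ∑ l, pd a (pd b (pd l (pd l Ψ))) z := by
    rw [pd_sum _ b (fun l _ => ((tΨ.pd l).pd l).diff),
      pd_sum _ a (fun l _ => (((tΨ.pd l).pd l).pd b).diff)]
  have e4 := congrFun e2 z
  rw [e1, e3] at e4
  rw [← e4]
  refine Finset.sum_congr rfl fun l _ => ?_
  rw [pd4_comm tΨ.smooth, hΨ, pd2_sc a b hr hΦ.tf]

theorem telescope {d : ℕ} {φ Φ : E d → ℝ} (hφ : Ker φ) (hΦ : Ker Φ)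
    (hlap : ∀ z, ∑ i, pd i (pd i Φ) z = φ z - sc (1/2) φ z) (a b : Fin d)
    {u : E d → ℝ} {v : Fin d → E d → ℝ} {f : E d → ℝ} {Z : Set (E d)}
    {α K G : ℝ} (D : Dat u v f Z α K G) (k : ℕ) {x : E d} (hx : ‖x‖ ≤ 3/4) :
    AA φ a b u k x - AA φ a b u (k+1) x = cv (sc (rr k) (pd a (pd b Φ))) (gg v) x := by
  obtain ⟨Lu, hLu⟩ := D.uLip
  obtain ⟨Lv, hLv⟩ := D.vLip
  have hr := rr_pos k
  have hκ : Ker (pd a (pd b Φ)) := (hΦ.pd b).pd a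
  have tκ := sc_tf hr hκ.tf
  have tk : ∀ j, TF (pd a (pd b (sc (rr j) φ))) := fun j => ((sc_tf (rr_pos j) hφ.tf).pd b).pd a
  have e0 : AA φ a b u k x - AA φ a b u (k+1) x
      = ∑ l, cv (pd l (pd l (sc (rr k) (pd a (pd b Φ))))) u x := by
    unfold AA cv
    rw [← integral_sub (cv_integrable (tk k) D.uLoc x) (cv_integrable (tk (k+1)) D.uLoc x),
      ← integral_finsetSum _ fun l _ => cv_integrable ((tκ.pd l).pd l) D.uLoc x]
    congr 1; funext z
    rw [← Finset.sum_mul, ← lap_kernel hφ hΦ hlap a b hr, sub_mul, rr_succ]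
  rw [e0]
  have e1 : ∀ l, cv (pd l (pd l (sc (rr k) (pd a (pd b Φ))))) u x
      = cv (sc (rr k) (pd a (pd b Φ))) (pd l (v l)) x := by
    intro l
    rw [cv_ibp (tκ.pd l) hLu, ← cv_ibp tκ (hLv l)]
    exact cv_congr' (pd_sc_zero hr hκ l) (Eventually.of_forall fun z hz =>
      D.grad z (sub_unit_ball hx k hz) l)
  simp_rw [e1]
  unfold cv gg
  rw [← integral_finsetSum _ fun l _ => cv_integrable tκ (pd_locInt (hLv l) l) x]
  simp_rw [Finset.mul_sum]

theorem cv_first {d : ℕ} {φ : E d → ℝ} (hφ : Ker φ) (b : Fin d)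
    {u : E d → ℝ} {v : Fin d → E d → ℝ} {f : E d → ℝ} {Z : Set (E d)}
    {α K G : ℝ} (D : Dat u v f Z α K G) (k : ℕ) {x : E d} (hx : ‖x‖ ≤ 3/4) :
    cv (pd b (sc (rr k) φ)) u x = cv (sc (rr k) φ) (v b) x := by
  obtain ⟨Lu, hLu⟩ := D.uLip
  rw [cv_ibp (sc_tf (rr_pos k) hφ.tf) hLu]
  exact cv_congr (rr_pos k) hφ (Eventually.of_forall fun z hz => D.grad z (sub_unit_ball hx k hz) b)

theorem AA_eq {d : ℕ} {φ : E d → ℝ} (hφ : Ker φ) (a b : Fin d)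
    {u : E d → ℝ} {v : Fin d → E d → ℝ} {f : E d → ℝ} {Z : Set (E d)}
    {α K G : ℝ} (D : Dat u v f Z α K G) (k : ℕ) {x : E d} (hx : ‖x‖ ≤ 3/4) :
    AA φ a b u k x = (rr k)⁻¹ * cv (sc (rr k) (pd a φ)) (v b) x := by
  obtain ⟨Lu, hLu⟩ := D.uLip
  have t := sc_tf (rr_pos k) hφ.tf
  unfold AA
  rw [pd_comm a b t.smooth, cv_ibp (t.pd a) hLu,
    cv_congr' (w' := v b) (pd_sc_zero (rr_pos k) hφ a) (Eventually.of_forall fun z hz =>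
      D.grad z (sub_unit_ball hx k hz) b), pd_sc a _ hφ.tf.diff]
  unfold cv
  rw [← integral_const_mul]
  congr 1; funext z; ring

theorem AA_tendsto {d : ℕ} {φ : E d → ℝ} (hφ : Ker φ) (h1 : ∫ z, φ z = 1) (a b : Fin d)
    {u : E d → ℝ} {v : Fin d → E d → ℝ} {f : E d → ℝ} {Z : Set (E d)}
    {α K G : ℝ} (D : Dat u v f Z α K G) {x : E d} (hx : ‖x‖ ≤ 3/4)
    (hd : DifferentiableAt ℝ (v b) x) :
    Tendsto (fun k => AA φ a b u k x) atTop (𝓝 (pd a (v b) x)) := by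
  obtain ⟨Lv, hLv⟩ := D.vLip
  have k1 := (hφ.pd a).tf
  have hzi : ∫ y, pd a φ y = 0 := by
    have := tf_ibp_one hφ.tf a
    exact this
  have e : ∀ k, AA φ a b u k x
      = ∫ y, pd a φ y * ((rr k)⁻¹ * (v b (x - rr k • y) - v b x)) := by
    intro k
    rw [AA_eq hφ a b D k hx, cv_sc (rr_pos k), ← integral_const_mul]
    have i1 : Integrable (fun y => pd a φ y * ((rr k)⁻¹ * v b (x - rr k • y))) := by
      apply Continuous.integrable_of_hasCompactSupport
      · exact k1.cont.mul (continuous_const.mul ((hLv b).continuous.comp (by fun_prop)))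
      · exact k1.cs.mul_right
    have i2 : Integrable (fun y => pd a φ y * ((rr k)⁻¹ * v b x)) := k1.integrable.mul_const _
    have : ∀ y, pd a φ y * ((rr k)⁻¹ * (v b (x - rr k • y) - v b x))
        = pd a φ y * ((rr k)⁻¹ * v b (x - rr k • y)) - pd a φ y * ((rr k)⁻¹ * v b x) := by
      intro y; ring
    simp_rw [this]
    rw [integral_sub i1 i2, integral_mul_const, hzi, zero_mul, sub_zero]
    congr 1; funext y; ring
  simp_rw [e]
  set T := fderiv ℝ (v b) x with hT
  have lim : ∫ y, pd a φ y * (-(T y)) = pd a (v b) x := by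
    have hTl : LipschitzWith ‖T‖₊ (fun y => T y) := T.lipschitz
    have := cv_ibp hφ.tf hTl a 0
    unfold cv at this
    rw [← integral_sub_left_eq_self _ volume 0, ← integral_sub_left_eq_self (fun z => φ (0 - z) * pd a (fun y => T y) z) volume 0] at this
    simp only [zero_sub, neg_neg, map_neg] at this
    rw [this]
    have hp : ∀ z, pd a (fun y => T y) z = pd a (v b) x := by
      intro z
      unfold pd
      rw [T.hasFDerivAt.fderiv]
    simp_rw [hp]
    rw [integral_mul_const, h1, one_mul]
  rw [← lim]
  refine tendsto_integral_of_dominated_convergence (fun y => |pd a φ y| * (Lv * ‖y‖)) ?_ ?_ ?_ ?_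
  · intro k
    exact (k1.cont.mul (continuous_const.mul (((hLv b).continuous.comp (by fun_prop)).sub
      continuous_const))).aestronglyMeasurable
  · apply Continuous.integrable_of_hasCompactSupport
    · exact k1.cont.abs.mul (by fun_prop)
    · exact (k1.cs.abs).mul_right
  · intro k
    refine Eventually.of_forall fun y => ?_
    rw [Real.norm_eq_abs, abs_mul, abs_mul]
    refine mul_le_mul_of_nonneg_left ?_ (abs_nonneg _)
    have hl := (hLv b).dist_le_mul (x - rr k • y) x
    rw [Real.dist_eq, dist_eq_norm, sub_sub_cancel_left, norm_neg, norm_smul,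
      Real.norm_of_nonneg (rr_pos k).le] at hl
    rw [abs_of_pos (inv_pos.2 (rr_pos k)), inv_mul_le_iff₀ (rr_pos k)]
    linarith
  · refine Eventually.of_forall fun y => ?_
    refine Tendsto.const_mul _ ?_
    have hline : HasDerivAt (fun t : ℝ => v b (x - t • y)) (-(T y)) 0 := by
      have hh : HasFDerivAt (v b) T (x - (0:ℝ) • y) := by simpa using hd.hasFDerivAt
      have h2 : HasDerivAt (fun t : ℝ => x - t • y) (-y) 0 := by
        have := ((hasDerivAt_id (0:ℝ)).smul_const y).const_sub x
        simpa using this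
      have := hh.comp_hasDerivAt (0:ℝ) h2
      simp only [map_neg] at this
      exact this
    have h3 := hasDerivAt_iff_tendsto_slope.1 hline
    have h4 : Tendsto rr atTop (𝓝[≠] 0) :=
      tendsto_nhdsWithin_iff.2 ⟨rr_tendsto, Eventually.of_forall fun k => (rr_pos k).ne'⟩
    refine (h3.comp h4).congr fun k => ?_
    simp [slope, Function.comp]

theorem AA_zero_bound {d : ℕ} {φ : E d → ℝ} (hφ : Ker φ) (a b : Fin d)
    {u : E d → ℝ} {v : Fin d → E d → ℝ} {f : E d → ℝ} {Z : Set (E d)}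
    {α K G : ℝ} (D : Dat u v f Z α K G) {x : E d} (hx : ‖x‖ ≤ 3/4) :
    |AA φ a b u 0 x| ≤ 64 * ((∫ z, |pd a (pd b φ) z|) * K) := by
  have h : AA φ a b u 0 x = 64 * cv (sc (rr 0) (pd a (pd b φ))) u x := by
    have := pd2_sc a b (rr_pos 0) hφ.tf
    rw [← this]
    unfold AA cv
    rw [pd_const_mul b _ (sc_tf (rr_pos 0) hφ.tf).diff,
      pd_const_mul a _ ((sc_tf (rr_pos 0) hφ.tf).pd b).diff, ← integral_const_mul]
    congr 1; funext z
    unfold rr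
    ring
  rw [h, abs_mul, abs_of_pos (by norm_num : (0:ℝ) < 64)]
  refine mul_le_mul_of_nonneg_left ?_ (by norm_num)
  exact cv_bound (rr_pos 0) ((hφ.pd b).pd a) (Eventually.of_forall fun z hz =>
    D.ub z (sub_unit_ball hx 0 hz))


theorem seq_bound {c0 c1 c2 w0 N q : ℝ} (h1 : 0 ≤ c1) (h2 : 0 ≤ c2) (hq0 : 0 ≤ q) (hq : q < 1)
    {A l : ℕ → ℝ} (hl0 : ∀ k, 0 ≤ l k) (hl : ∀ k, l k ≤ w0) (hA0 : A 0 ≤ c0)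
    (hstep : ∀ k, A (k+1) ≤ A k + c1 * q^k + c2 * l k)
    (hdec : ∀ k, N ≤ A (k+1) → l (k+1) ≤ l k / 2) (k : ℕ) :
    A k ≤ |c0| + |N| + 2 * c2 * w0 + c1 / (1 - q) := by
  have hq1 : 0 < 1 - q := by linarith
  set c := c1 / (1 - q) with hc
  have hc0 : 0 ≤ c := div_nonneg h1 hq1.le
  have hcq : c1 + c * q = c := by rw [hc]; field_simp; ring
  have key : ∀ k, A k + 2 * c2 * l k + c * q^k ≤ |c0| + |N| + 2 * c2 * w0 + c := by
    intro k
    induction k with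
    | zero =>
      have := mul_le_mul_of_nonneg_left (hl 0) h2
      simp only [pow_zero, mul_one]
      linarith [le_abs_self c0, abs_nonneg N]
    | succ k ih =>
      by_cases hN : N ≤ A (k+1)
      · have e1 := mul_le_mul_of_nonneg_left (hdec k hN) h2
        have e2 := hstep k
        have e3 : c * q^(k+1) + c1 * q^k = c * q^k := by
          rw [pow_succ]; linear_combination q^k * hcq
        linarith
      · have e1 := mul_le_mul_of_nonneg_left (hl (k+1)) h2
        have e2 : c * q^(k+1) ≤ c := mul_le_of_le_one_right hc0 (pow_le_one₀ hq0 hq.le)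
        linarith [le_abs_self N, abs_nonneg c0]
  have := key k
  have e1 := mul_nonneg h2 (hl0 k)
  have e2 := mul_nonneg hc0 (pow_nonneg hq0 k)
  linarith

theorem rr_rpow {α : ℝ} (hα : 0 < α) (k : ℕ) : rr k ^ α ≤ (((1:ℝ)/2)^α)^k := by
  unfold rr
  rw [← Real.rpow_natCast, ← Real.rpow_mul (by norm_num), mul_comm, Real.rpow_mul (by norm_num),
    Real.rpow_natCast]
  exact pow_le_pow_of_le_one (by positivity) (Real.rpow_le_one (by norm_num) (by norm_num) hα.le)
    (by omega)

theorem Dat.fLoc {d : ℕ} {u : E d → ℝ} {v : Fin d → E d → ℝ} {f : E d → ℝ} {Z : Set (E d)}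
    {α K G : ℝ} (D : Dat u v f Z α K G) : LocallyIntegrable f :=
  locInt_of_bdd D.fm (Eventually.of_forall D.fb)

theorem cv_f_bound {d : ℕ} {Ψ : E d → ℝ} (hΨ : Ker Ψ) (a : Fin d)
    {u : E d → ℝ} {v : Fin d → E d → ℝ} {f : E d → ℝ} {Z : Set (E d)}
    {α K G : ℝ} (hα : 0 < α) (hK : 0 ≤ K) (D : Dat u v f Z α K G) (k : ℕ) {x : E d}
    (hx : ‖x‖ ≤ 3/4) :
    |cv (sc (rr k) (pd a Ψ)) f x| ≤ (∫ z, |pd a Ψ z|) * (K * rr k ^ α) := by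
  have hκ := hΨ.pd a
  have tκ := sc_tf (rr_pos k) hκ.tf
  have e : cv (sc (rr k) (pd a Ψ)) f x = cv (sc (rr k) (pd a Ψ)) (fun z => f z - f x) x := by
    unfold cv
    simp_rw [mul_sub]
    rw [integral_sub (cv_integrable tκ D.fLoc x) ((tκ.integrable.comp_sub_left x).mul_const _),
      integral_mul_const]
    have h0 := cv_sc (rr_pos k) (pd a Ψ) (fun _ => 1) x
    unfold cv at h0
    simp only [mul_one] at h0
    rw [h0, tf_ibp_one hΨ.tf a, zero_mul, sub_zero]
  rw [e]
  refine cv_bound (rr_pos k) hκ (Eventually.of_forall fun z hz => ?_)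
  have hx1 : x ∈ ball (0 : E d) 1 := by rw [mem_ball_zero_iff]; linarith
  refine (D.fH z (sub_unit_ball hx k hz) x hx1).trans (mul_le_mul_of_nonneg_left ?_ hK)
  rw [mem_ball, dist_eq_norm] at hz
  exact Real.rpow_le_rpow (norm_nonneg _) hz.le hα.le

theorem cv_g_osc {d : ℕ} {κ : E d → ℝ} (hκ : Ker κ)
    {u : E d → ℝ} {v : Fin d → E d → ℝ} {f : E d → ℝ} {Z : Set (E d)}
    {α K G : ℝ} (D : Dat u v f Z α K G) (k : ℕ) {x y : E d}
    (hx : ‖x‖ ≤ 3/4) (hy : ‖y‖ ≤ 3/4) :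
    |cv (sc (rr k) κ) (gg v) x - cv (sc (rr k) κ) (gg v) y|
      ≤ ((∑ l, ∫ z, |pd l κ z|) * G) * (‖x - y‖ * (rr k)⁻¹) := by
  have tκ := sc_tf (rr_pos k) hκ.tf
  have hsm := cv_smooth tκ D.gLoc
  have hb : ∀ p ∈ closedBall (0 : E d) (3/4), ‖fderiv ℝ (cv (sc (rr k) κ) (gg v)) p‖
      ≤ ((∑ l, ∫ z, |pd l κ z|) * G) * (rr k)⁻¹ := by
    intro p hp
    rw [mem_closedBall_zero_iff] at hp
    refine abs_fderiv_le.trans ?_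
    rw [Finset.sum_mul, Finset.sum_mul]
    refine Finset.sum_le_sum fun l _ => ?_
    rw [cv_pd tκ D.gLoc, pd_sc l _ hκ.tf.diff]
    have e : cv (fun z => (rr k)⁻¹ * sc (rr k) (pd l κ) z) (gg v) p
        = (rr k)⁻¹ * cv (sc (rr k) (pd l κ)) (gg v) p := by
      unfold cv
      rw [← integral_const_mul]
      congr 1; funext z; ring
    rw [e, abs_mul, abs_of_pos (inv_pos.2 (rr_pos k)), mul_comm]
    refine mul_le_mul_of_nonneg_right ?_ (inv_pos.2 (rr_pos k)).le
    refine cv_bound (rr_pos k) (hκ.pd l) ?_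
    filter_upwards [D.gb] with z hz hzb
    exact hz (sub_unit_ball hp k hzb)
  have := (convex_closedBall (0 : E d) (3/4)).norm_image_sub_le_of_norm_fderiv_le
    (fun p _ => hsm.differentiable (by simp) p) hb
    (mem_closedBall_zero_iff.2 hy) (mem_closedBall_zero_iff.2 hx)
  rw [Real.norm_eq_abs] at this
  refine this.trans (le_of_eq (by ring))

theorem AA_osc {d : ℕ} {φ Φ : E d → ℝ} (hφ : Ker φ) (hΦ : Ker Φ)
    (hlap : ∀ z, ∑ i, pd i (pd i Φ) z = φ z - sc (1/2) φ z) (a b : Fin d)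
    {u : E d → ℝ} {v : Fin d → E d → ℝ} {f : E d → ℝ} {Z : Set (E d)}
    {α K G : ℝ} (hG : 0 ≤ G) (D : Dat u v f Z α K G) {x y : E d}
    (hx : ‖x‖ ≤ 3/4) (hy : ‖y‖ ≤ 3/4) (k : ℕ) :
    |AA φ a b u k x - AA φ a b u k y| ≤ 128 * ((∫ z, |pd a (pd b φ) z|) * K)
      + 2 * ((∑ l, ∫ z, |pd l (pd a (pd b Φ)) z|) * G) * (‖x - y‖ * (rr k)⁻¹) := by
  set P := (∑ l, ∫ z, |pd l (pd a (pd b Φ)) z|) * G with hP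
  have hP0 : 0 ≤ P := mul_nonneg (Finset.sum_nonneg fun l _ => integral_nonneg fun z => abs_nonneg _) hG
  induction k with
  | zero =>
    have h1 := AA_zero_bound hφ a b D hx
    have h2 := AA_zero_bound hφ a b D hy
    have h3 := abs_sub (AA φ a b u 0 x) (AA φ a b u 0 y)
    have h4 : 0 ≤ 2 * P * (‖x - y‖ * (rr 0)⁻¹) :=
      mul_nonneg (by linarith) (mul_nonneg (norm_nonneg _) (inv_pos.2 (rr_pos 0)).le)
    linarith
  | succ k ih =>
    have t1 := telescope hφ hΦ hlap a b D k hx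
    have t2 := telescope hφ hΦ hlap a b D k hy
    have o := cv_g_osc ((hΦ.pd b).pd a) D k hx hy
    rw [← hP] at o
    have hr : (rr (k+1))⁻¹ = 2 * (rr k)⁻¹ := by rw [rr_succ, inv_div, div_eq_mul_inv]
    have h4 : 0 ≤ P * (‖x - y‖ * (rr k)⁻¹) :=
      mul_nonneg hP0 (mul_nonneg (norm_nonneg _) (inv_pos.2 (rr_pos k)).le)
    rw [hr]
    have e : AA φ a b u (k+1) x - AA φ a b u (k+1) y = (AA φ a b u k x - AA φ a b u k y)
      - (cv (sc (rr k) (pd a (pd b Φ))) (gg v) x - cv (sc (rr k) (pd a (pd b Φ))) (gg v) y) := by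
      linarith
    rw [e]
    have := abs_sub (AA φ a b u k x - AA φ a b u k y)
      (cv (sc (rr k) (pd a (pd b Φ))) (gg v) x - cv (sc (rr k) (pd a (pd b Φ))) (gg v) y)
    linarith

/-- the defect on the contact set -/
def hh {d : ℕ} (v : Fin d → E d → ℝ) (f : E d → ℝ) (Z : Set (E d)) (x0 : E d) (k : ℕ) : E d → ℝ :=
  (Z ∩ ball x0 (rr k)).indicator fun z => f z - gg v z

/-- measure of the contact set in a ball -/
def VV {d : ℕ} (Z : Set (E d)) (x0 : E d) (k : ℕ) : ℝ := volume.real (Z ∩ ball x0 (rr k))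

theorem VV_fin {d : ℕ} (Z : Set (E d)) (x0 : E d) (k : ℕ) : volume (Z ∩ ball x0 (rr k)) ≠ ⊤ :=
  ((measure_mono inter_subset_right).trans_lt measure_ball_lt_top).ne

theorem hh_bound {d : ℕ} {u : E d → ℝ} {v : Fin d → E d → ℝ} {f : E d → ℝ} {Z : Set (E d)}
    {α K G : ℝ} (D : Dat u v f Z α K G) {x0 : E d} (hx : ‖x0‖ ≤ 3/4) (k : ℕ) :
    ∀ᵐ z, |hh v f Z x0 k z| ≤ (Z ∩ ball x0 (rr k)).indicator (fun _ => K + G) z := by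
  filter_upwards [D.gb] with z hz
  unfold hh
  by_cases hm : z ∈ Z ∩ ball x0 (rr k)
  · rw [indicator_of_mem hm, indicator_of_mem hm]
    have := hz (sub_unit_ball hx k hm.2)
    exact (abs_sub _ _).trans (add_le_add (D.fb z) this)
  · rw [indicator_of_notMem hm, indicator_of_notMem hm, abs_zero]

theorem hh_bound' {d : ℕ} {u : E d → ℝ} {v : Fin d → E d → ℝ} {f : E d → ℝ} {Z : Set (E d)}
    {α K G : ℝ} (hK : 0 ≤ K) (hG : 0 ≤ G) (D : Dat u v f Z α K G) {x0 : E d} (hx : ‖x0‖ ≤ 3/4)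
    (k : ℕ) : ∀ᵐ z, |hh v f Z x0 k z| ≤ K + G := by
  filter_upwards [hh_bound D hx k] with z hz
  exact hz.trans (indicator_le_self' (fun _ _ => by linarith) z)

theorem hh_ind_int {d : ℕ} {Z : Set (E d)} (Zm : MeasurableSet Z) (x0 : E d) (k : ℕ) (c : ℝ) :
    Integrable ((Z ∩ ball x0 (rr k)).indicator (fun _ => c)) :=
  (integrable_indicator_iff (Zm.inter measurableSet_ball)).2
    (integrableOn_const (VV_fin Z x0 k))

theorem hh_integrable {d : ℕ} {u : E d → ℝ} {v : Fin d → E d → ℝ} {f : E d → ℝ} {Z : Set (E d)}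
    {α K G : ℝ} (D : Dat u v f Z α K G) {x0 : E d} (hx : ‖x0‖ ≤ 3/4) (k : ℕ) :
    Integrable (hh v f Z x0 k) := by
  refine (hh_ind_int D.Zm x0 k (K+G)).mono' ?_ (hh_bound D hx k)
  exact (D.fm.sub (gg_meas v).aestronglyMeasurable).indicator (D.Zm.inter measurableSet_ball)

theorem hh_abs {d : ℕ} {u : E d → ℝ} {v : Fin d → E d → ℝ} {f : E d → ℝ} {Z : Set (E d)}
    {α K G : ℝ} (D : Dat u v f Z α K G) {x0 : E d} (hx : ‖x0‖ ≤ 3/4) (k : ℕ) :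
    ∫ z, |hh v f Z x0 k z| ≤ (K + G) * VV Z x0 k := by
  refine (integral_mono_ae (hh_integrable D hx k).abs (hh_ind_int D.Zm x0 k (K+G))
    (hh_bound D hx k)).trans ?_
  rw [integral_indicator (D.Zm.inter measurableSet_ball), setIntegral_const, smul_eq_mul, mul_comm]
  rfl

theorem hh_cs {d : ℕ} (v : Fin d → E d → ℝ) (f : E d → ℝ) (Z : Set (E d)) (x0 : E d) (k : ℕ) :
    HasCompactSupport (hh v f Z x0 k) := by
  refine HasCompactSupport.intro (isCompact_closedBall x0 (rr k)) fun z hz => ?_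
  unfold hh
  exact indicator_of_notMem (fun h => hz (ball_subset_closedBall h.2)) _

theorem hh_split {d : ℕ} {κ : E d → ℝ} (hκ : Ker κ)
    {u : E d → ℝ} {v : Fin d → E d → ℝ} {f : E d → ℝ} {Z : Set (E d)}
    {α K G : ℝ} (D : Dat u v f Z α K G) {x0 x : E d} (hx : ‖x0‖ ≤ 3/4) (k j : ℕ)
    (hsub : ball x (rr j) ⊆ ball x0 (rr k)) :
    cv (sc (rr j) κ) (gg v) x = cv (sc (rr j) κ) f x - cv (sc (rr j) κ) (hh v f Z x0 k) x := by
  have tκ := sc_tf (rr_pos j) hκ.tf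
  rw [cv_congr (w' := fun z => f z - hh v f Z x0 k z) (rr_pos j) hκ]
  · unfold cv
    rw [← integral_sub (cv_integrable tκ D.fLoc x)
      (cv_integrable tκ (hh_integrable D hx k).locallyIntegrable x)]
    congr 1; funext z; ring
  · filter_upwards [D.geq] with z hz hzb
    unfold hh
    by_cases hm : z ∈ Z
    · rw [indicator_of_mem (show z ∈ Z ∩ ball x0 (rr k) from ⟨hm, hsub hzb⟩)]; ring
    · rw [indicator_of_notMem (fun h => hm h.1), sub_zero]
      exact hz (sub_unit_ball hx k (hsub hzb)) hm

theorem hh_center {d : ℕ} {κ : E d → ℝ} {M : ℝ} (hM0 : 0 ≤ M)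
    (hM : ∀ z, |κ z| ≤ M)
    {u : E d → ℝ} {v : Fin d → E d → ℝ} {f : E d → ℝ} {Z : Set (E d)}
    {α K G : ℝ} (D : Dat u v f Z α K G) {x0 : E d} (hx : ‖x0‖ ≤ 3/4) (k : ℕ) :
    |cv (sc (rr k) κ) (hh v f Z x0 k) x0| ≤ M * (K + G) * ((rr k ^ d)⁻¹ * VV Z x0 k) := by
  have hp : 0 < (rr k ^ d)⁻¹ := inv_pos.2 (pow_pos (rr_pos k) d)
  have h1 : |cv (sc (rr k) κ) (hh v f Z x0 k) x0|
      ≤ ∫ z, ((rr k ^ d)⁻¹ * M) * |hh v f Z x0 k z| := by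
    unfold cv
    rw [← Real.norm_eq_abs (∫ z, sc (rr k) κ (x0 - z) * hh v f Z x0 k z)]
    refine norm_integral_le_of_norm_le ((hh_integrable D hx k).abs.const_mul _) ?_
    refine Eventually.of_forall fun z => ?_
    rw [Real.norm_eq_abs, abs_mul]
    refine mul_le_mul_of_nonneg_right ?_ (abs_nonneg _)
    unfold sc
    rw [abs_mul, abs_of_pos hp]
    exact mul_le_mul_of_nonneg_left (hM _) hp.le
  rw [integral_const_mul] at h1
  have h2 := mul_le_mul_of_nonneg_left (hh_abs D hx k) (mul_nonneg hp.le hM0)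
  linarith

theorem VV_le {d : ℕ} (Z : Set (E d)) (x0 : E d) (k : ℕ) :
    (rr k ^ d)⁻¹ * VV Z x0 k ≤ volume.real (ball (0 : E d) 1) := by
  have h1 : VV Z x0 k ≤ volume.real (ball x0 (rr k)) :=
    measureReal_mono inter_subset_right measure_ball_lt_top.ne
  have h2 : volume.real (ball x0 (rr k)) = rr k ^ d * volume.real (ball (0 : E d) 1) := by
    unfold Measure.real
    rw [Measure.addHaar_ball_of_pos _ _ (rr_pos k), ENNReal.toReal_mul,
      ENNReal.toReal_ofReal (pow_pos (rr_pos k) _).le]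
    simp
  rw [inv_mul_le_iff₀ (pow_pos (rr_pos k) d)]
  linarith


theorem geom_sum_le {q : ℝ} (hq0 : 0 ≤ q) (hq : q < 1) (k m : ℕ) :
    ∑ j ∈ Finset.Ico k m, q^j ≤ (1 - q)⁻¹ := by
  rw [← tsum_geometric_of_lt_one hq0 hq]
  exact (summable_geometric_of_lt_one hq0 hq).sum_le_tsum _ fun i _ => pow_nonneg hq0 i

theorem telescope_sum {d : ℕ} {φ Φ : E d → ℝ} (hφ : Ker φ) (hΦ : Ker Φ)
    (hlap : ∀ z, ∑ i, pd i (pd i Φ) z = φ z - sc (1/2) φ z) (a b : Fin d)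
    {u : E d → ℝ} {v : Fin d → E d → ℝ} {f : E d → ℝ} {Z : Set (E d)}
    {α K G : ℝ} (D : Dat u v f Z α K G) {x : E d} (hx : ‖x‖ ≤ 3/4) (k m : ℕ) (hkm : k ≤ m) :
    AA φ a b u m x = AA φ a b u k x
      - ∑ j ∈ Finset.Ico k m, cv (sc (rr j) (pd a (pd b Φ))) (gg v) x := by
  induction m, hkm using Nat.le_induction with
  | base => simp
  | succ m hkm ih =>
    rw [Finset.sum_Ico_succ_top hkm]
    linarith [telescope hφ hΦ hlap a b D m hx]

theorem pointwise_big {d : ℕ} {φ Φ : E d → ℝ} (hφ : Ker φ) (hΦ : Ker Φ) (h1 : ∫ z, φ z = 1)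
    (hlap : ∀ z, ∑ i, pd i (pd i Φ) z = φ z - sc (1/2) φ z) (a b : Fin d)
    {u : E d → ℝ} {v : Fin d → E d → ℝ} {f : E d → ℝ} {Z : Set (E d)}
    {α K G T : ℝ} (hα : 0 < α) (hK : 0 ≤ K) (hG : 0 ≤ G) (hT : 0 ≤ T) (D : Dat u v f Z α K G) {x0 : E d}
    (hx0 : ‖x0‖ ≤ 1/2) (k : ℕ)
    (hN : T + 1 + K + (∫ z, |pd a (pd b Φ) z|) * (K * (1 - ((1:ℝ)/2)^α)⁻¹)
      + (128 * ((∫ z, |pd a (pd b φ) z|) * K)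
        + 2 * ((∑ l, ∫ z, |pd l (pd a (pd b Φ)) z|) * G)) ≤ |AA φ a b u (k+1) x0|) {x : E d}
    (hx : x ∈ ball x0 (rr (k+1))) (hd : DifferentiableAt ℝ (v b) x)
    (hb : |pd a (v b) x| ≤ K) :
    ∀ᶠ m in atTop, T^2 ≤ (∑ j ∈ Finset.Ico (k+1) m,
      cv (sc (rr j) (pd a (pd b Φ))) (hh v f Z x0 k) x)^2 := by
  have hxd : ‖x - x0‖ < rr (k+1) := by rwa [mem_ball, dist_eq_norm] at hx
  have hx34 : ‖x‖ ≤ 3/4 := by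
    have := norm_le_norm_add_norm_sub' x x0
    linarith [rr_le (k+1)]
  have hx034 : ‖x0‖ ≤ 3/4 := by linarith
  have hq0 : (0:ℝ) ≤ (1/2)^α := by positivity
  have hq : ((1:ℝ)/2)^α < 1 := Real.rpow_lt_one (by norm_num) (by norm_num) hα
  have hlim := (AA_tendsto hφ h1 a b D hx34 hd).abs
  have hev : ∀ᶠ m in atTop, |AA φ a b u m x| < K + 1 :=
    hlim.eventually_lt_const (by linarith)
  filter_upwards [hev, eventually_ge_atTop (k+1)] with m hm hkm
  have ts := telescope_sum hφ hΦ hlap a b D hx34 (k+1) m hkm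
  have hs : ∑ j ∈ Finset.Ico (k+1) m, cv (sc (rr j) (pd a (pd b Φ))) (gg v) x
      = ∑ j ∈ Finset.Ico (k+1) m, cv (sc (rr j) (pd a (pd b Φ))) f x
       - ∑ j ∈ Finset.Ico (k+1) m, cv (sc (rr j) (pd a (pd b Φ))) (hh v f Z x0 k) x := by
    rw [← Finset.sum_sub_distrib]
    refine Finset.sum_congr rfl fun j hj => ?_
    refine hh_split ((hΦ.pd b).pd a) D hx034 k j (ball_subset_ball' ?_)
    have := rr_anti (Finset.mem_Ico.1 hj).1
    rw [rr_succ] at this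
    rw [dist_eq_norm]
    rw [rr_succ] at hxd
    linarith
  rw [hs] at ts
  have hF : |∑ j ∈ Finset.Ico (k+1) m, cv (sc (rr j) (pd a (pd b Φ))) f x|
      ≤ (∫ z, |pd a (pd b Φ) z|) * (K * (1 - ((1:ℝ)/2)^α)⁻¹) := by
    refine (Finset.abs_sum_le_sum_abs _ _).trans ?_
    have hI : 0 ≤ ∫ z, |pd a (pd b Φ) z| := integral_nonneg fun z => abs_nonneg _
    calc ∑ j ∈ Finset.Ico (k+1) m, |cv (sc (rr j) (pd a (pd b Φ))) f x|
        ≤ ∑ j ∈ Finset.Ico (k+1) m, (∫ z, |pd a (pd b Φ) z|) * (K * (((1:ℝ)/2)^α)^j) :=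
          Finset.sum_le_sum fun j _ => (cv_f_bound (hΦ.pd b) a hα hK D j hx34).trans
            (mul_le_mul_of_nonneg_left (mul_le_mul_of_nonneg_left (rr_rpow hα j) hK) hI)
      _ = (∫ z, |pd a (pd b Φ) z|) * (K * ∑ j ∈ Finset.Ico (k+1) m, (((1:ℝ)/2)^α)^j) := by
          rw [Finset.mul_sum, Finset.mul_sum]
      _ ≤ _ := mul_le_mul_of_nonneg_left (mul_le_mul_of_nonneg_left (geom_sum_le hq0 hq _ _) hK) hI
  have hO := AA_osc hφ hΦ hlap a b hG D hx34 hx034 (k+1)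
  have hr1 : ‖x - x0‖ * (rr (k+1))⁻¹ ≤ 1 := by
    rw [mul_inv_le_iff₀ (rr_pos _)]; linarith
  set P := (∑ l, ∫ z, |pd l (pd a (pd b Φ)) z|) * G with hP
  have hP0 : 0 ≤ P := mul_nonneg (Finset.sum_nonneg fun l _ => integral_nonneg fun z => abs_nonneg _) hG
  have hO2 : 2 * P * (‖x - x0‖ * (rr (k+1))⁻¹) ≤ 2 * P :=
    mul_le_of_le_one_right (by linarith) hr1
  set S := ∑ j ∈ Finset.Ico (k+1) m, cv (sc (rr j) (pd a (pd b Φ))) (hh v f Z x0 k) x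
  set F := ∑ j ∈ Finset.Ico (k+1) m, cv (sc (rr j) (pd a (pd b Φ))) f x
  have e : AA φ a b u (k+1) x0
      = AA φ a b u m x + F - S - (AA φ a b u (k+1) x - AA φ a b u (k+1) x0) := by linarith
  have hab : |AA φ a b u (k+1) x0| ≤ |AA φ a b u m x| + |F| + |S|
      + |AA φ a b u (k+1) x - AA φ a b u (k+1) x0| := by
    conv_lhs => rw [e]
    refine (abs_sub _ _).trans (add_le_add ((abs_sub _ _).trans
      (add_le_add (abs_add_le _ _) le_rfl)) le_rfl)
  have hS : T ≤ |S| := by linarith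
  rw [← sq_abs S]
  exact pow_le_pow_left₀ hT hS 2

theorem decay {d : ℕ} {φ Φ : E d → ℝ} (hφ : Ker φ) (hΦ : Ker Φ) (h1 : ∫ z, φ z = 1)
    (hlap : ∀ z, ∑ i, pd i (pd i Φ) z = φ z - sc (1/2) φ z) (a b : Fin d)
    {u : E d → ℝ} {v : Fin d → E d → ℝ} {f : E d → ℝ} {Z : Set (E d)}
    {α K G T : ℝ} (hα : 0 < α) (hK : 0 ≤ K) (hG : 0 ≤ G) (hT : 0 ≤ T) (D : Dat u v f Z α K G)
    {x0 : E d} (hx0 : ‖x0‖ ≤ 1/2) (k : ℕ)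
    (hN : T + 1 + K + (∫ z, |pd a (pd b Φ) z|) * (K * (1 - ((1:ℝ)/2)^α)⁻¹)
      + (128 * ((∫ z, |pd a (pd b φ) z|) * K)
        + 2 * ((∑ l, ∫ z, |pd l (pd a (pd b Φ)) z|) * G)) ≤ |AA φ a b u (k+1) x0|) :
    T^2 * VV Z x0 (k+1) ≤ 4 * (∫ z, |φ z|)^2 * (K+G)^2 * VV Z x0 k := by
  have hx034 : ‖x0‖ ≤ 3/4 := by linarith
  obtain ⟨Lv, hLv⟩ := D.vLip
  set S : ℕ → E d → ℝ := fun m x => ∑ j ∈ Finset.Ico (k+1) m,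
      cv (sc (rr j) (pd a (pd b Φ))) (hh v f Z x0 k) x with hS
  have hi := hh_integrable D hx034 k
  have hL2 : ∀ m, k+1 ≤ m → Integrable (fun x => (S m x)^2) ∧ ∫ x, (S m x)^2
      ≤ 4 * (∫ z, |φ z|)^2 * (K+G)^2 * VV Z x0 k := fun m hm =>
    L2_bound hφ hΦ hlap a b (by linarith) hi (hh_cs v f Z x0 k) (hh_bound' hK hG D hx034 k)
      (hh_abs D hx034 k) (k+1) m hm
  set R := 4 * (∫ z, |φ z|)^2 * (K+G)^2 * VV Z x0 k with hR
  have hV0 : ∀ k, 0 ≤ VV Z x0 k := fun k => measureReal_nonneg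
  have hR0 : 0 ≤ R := by have := hV0 k; positivity
  have hSm : ∀ m, Measurable (fun x => ENNReal.ofReal ((S m x)^2)) := by
    intro m
    refine ENNReal.measurable_ofReal.comp (Measurable.pow_const ?_ 2)
    refine Finset.measurable_fun_sum _ fun j _ => ?_
    exact (cv_smooth (sc_tf (rr_pos j) ((hΦ.pd b).pd a).tf) hi.locallyIntegrable).continuous.measurable
  set A := Z ∩ ball x0 (rr (k+1)) with hA
  have hAm : MeasurableSet A := D.Zm.inter measurableSet_ball
  have key : ∀ᵐ x, A.indicator (fun _ => ENNReal.ofReal (T^2)) x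
      ≤ liminf (fun m => ENNReal.ofReal ((S m x)^2)) atTop := by
    filter_upwards [D.Zb, (hLv b).ae_differentiableAt] with x hZ hd
    by_cases hx : x ∈ A
    · rw [indicator_of_mem hx]
      refine le_liminf_of_le (by isBoundedDefault) ?_
      filter_upwards [pointwise_big hφ hΦ h1 hlap a b hα hK hG hT D hx0 k hN hx.2 hd
        (hZ (sub_unit_ball hx034 _ hx.2) hx.1 a b)] with m hm
      exact ENNReal.ofReal_le_ofReal hm
    · rw [indicator_of_notMem hx]; exact zero_le
  have h3 : ENNReal.ofReal (T^2) * volume A ≤ ENNReal.ofReal R := by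
    rw [← lintegral_indicator_const hAm]
    refine (lintegral_mono_ae key).trans ((lintegral_liminf_le hSm).trans ?_)
    refine liminf_le_of_frequently_le' (Eventually.frequently ?_)
    filter_upwards [eventually_ge_atTop (k+1)] with m hm
    rw [← ofReal_integral_eq_lintegral_ofReal (hL2 m hm).1
      (Eventually.of_forall fun x => sq_nonneg _)]
    exact ENNReal.ofReal_le_ofReal (hL2 m hm).2
  have h4 := ENNReal.toReal_mono ENNReal.ofReal_ne_top h3
  rw [ENNReal.toReal_mul, ENNReal.toReal_ofReal (sq_nonneg T), ENNReal.toReal_ofReal hR0] at h4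
  exact h4

theorem AA_bound {d : ℕ} {φ Φ : E d → ℝ} (hφ : Ker φ) (hΦ : Ker Φ) (h1 : ∫ z, φ z = 1)
    (hlap : ∀ z, ∑ i, pd i (pd i Φ) z = φ z - sc (1/2) φ z) (a b : Fin d)
    {α K G : ℝ} (hα : 0 < α) (hK : 0 ≤ K) (hG : 0 ≤ G) :
    ∃ C, ∀ (u : E d → ℝ) (v : Fin d → E d → ℝ) (f : E d → ℝ) (Z : Set (E d)),
      Dat u v f Z α K G → ∀ x0, ‖x0‖ ≤ 1/2 → ∀ k, |AA φ a b u k x0| ≤ C := by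
  have hκ := (hΦ.pd b).pd a
  obtain ⟨M, hM0, hM⟩ := hκ.tf.bdd
  have hq0 : (0:ℝ) ≤ (1/2)^α := by positivity
  have hq : ((1:ℝ)/2)^α < 1 := Real.rpow_lt_one (by norm_num) (by norm_num) hα
  set CL := 4 * (∫ z, |φ z|)^2 * (K+G)^2 with hCL
  have hCL0 : 0 ≤ CL := by positivity
  set T := 2 * 2^d * CL + 1 with hTd
  have hT1 : 1 ≤ T := by
    have : 0 ≤ 2 * 2^d * CL := by positivity
    linarith
  set I := ∫ z, |pd a (pd b Φ) z| with hI
  have hI0 : 0 ≤ I := integral_nonneg fun z => abs_nonneg _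
  set N := T + 1 + K + (∫ z, |pd a (pd b Φ) z|) * (K * (1 - ((1:ℝ)/2)^α)⁻¹)
      + (128 * ((∫ z, |pd a (pd b φ) z|) * K)
        + 2 * ((∑ l, ∫ z, |pd l (pd a (pd b Φ)) z|) * G)) with hNd
  refine ⟨_, fun u v f Z D x0 hx0 k => seq_bound (N := N) (A := fun k => |AA φ a b u k x0|)
    (l := fun k => (rr k ^ d)⁻¹ * VV Z x0 k) (q := ((1:ℝ)/2)^α) (c1 := I * K) (c2 := M * (K + G))
    (mul_nonneg hI0 hK) (mul_nonneg hM0 (by linarith)) hq0 hq ?_ (VV_le Z x0)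
    (AA_zero_bound hφ a b D (by linarith)) ?_
    (fun k hk => ?_) k⟩
  · intro k
    exact mul_nonneg (inv_pos.2 (pow_pos (rr_pos k) d)).le measureReal_nonneg
  · intro k
    have hx034 : ‖x0‖ ≤ 3/4 := by linarith
    have t := telescope hφ hΦ hlap a b D k hx034
    have s := hh_split hκ D hx034 k k (x := x0) subset_rfl
    have c1 := cv_f_bound (hΦ.pd b) a hα hK D k hx034
    have c2 := hh_center hM0 hM D hx034 k
    have c3 := mul_le_mul_of_nonneg_left (mul_le_mul_of_nonneg_left (rr_rpow hα k) hK) hI0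
    have e : AA φ a b u (k+1) x0 = AA φ a b u k x0 - (cv (sc (rr k) (pd a (pd b Φ))) f x0
        - cv (sc (rr k) (pd a (pd b Φ))) (hh v f Z x0 k) x0) := by linarith
    have e2 := abs_sub (AA φ a b u k x0) (cv (sc (rr k) (pd a (pd b Φ))) f x0
        - cv (sc (rr k) (pd a (pd b Φ))) (hh v f Z x0 k) x0)
    have e3 := abs_sub (cv (sc (rr k) (pd a (pd b Φ))) f x0)
        (cv (sc (rr k) (pd a (pd b Φ))) (hh v f Z x0 k) x0)
    rw [← e] at e2
    beta_reduce
    linarith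
  · have dc := decay hφ hΦ h1 hlap a b hα hK hG (zero_le_one.trans hT1) D hx0 k hk
    rw [← hCL] at dc
    beta_reduce
    have hV0 : 0 ≤ VV Z x0 (k+1) := measureReal_nonneg
    have hV1 : 0 ≤ VV Z x0 k := measureReal_nonneg
    have hp := inv_pos.2 (pow_pos (rr_pos k) d)
    have hr : (rr (k+1) ^ d)⁻¹ = 2^d * (rr k ^ d)⁻¹ := by
      rw [rr_succ, div_pow, inv_div, div_eq_mul_inv]
    rw [hr]
    have g1 : T * VV Z x0 (k+1) ≤ CL * VV Z x0 k := by
      refine le_trans (mul_le_mul_of_nonneg_right ?_ hV0) dc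
      nlinarith
    have g2 : 2 * 2^d * VV Z x0 (k+1) ≤ VV Z x0 k := by
      have g3 : T * (2 * 2^d * VV Z x0 (k+1)) ≤ T * VV Z x0 k := by
        have : 2 * 2^d * (T * VV Z x0 (k+1)) ≤ 2 * 2^d * (CL * VV Z x0 k) :=
          mul_le_mul_of_nonneg_left g1 (by positivity)
        have e : T * VV Z x0 k = 2 * 2^d * (CL * VV Z x0 k) + VV Z x0 k := by rw [hTd]; ring
        linarith
      exact le_of_mul_le_mul_left g3 (by linarith)
    have := mul_le_mul_of_nonneg_left g2 hp.le
    linarith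


theorem clm_norm_le {d : ℕ} (T : E d →L[ℝ] ℝ) : ‖T‖ ≤ ∑ i, |T (eb i)| := by
  have h := abs_fderiv_le (w := fun y => T y) (x := (0 : E d))
  have e : fderiv ℝ (fun y => T y) (0 : E d) = T := T.hasFDerivAt.fderiv
  unfold pd at h
  rwa [e] at h

theorem v_lip {d : ℕ} {φ : E d → ℝ} (hφ : Ker φ) (h1 : ∫ z, φ z = 1)
    {u : E d → ℝ} {v : Fin d → E d → ℝ} {f : E d → ℝ} {Z : Set (E d)}
    {α K G C : ℝ} (D : Dat u v f Z α K G)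
    (hC : ∀ a b, ∀ x0 : E d, ‖x0‖ ≤ 1/2 → ∀ k, |AA φ a b u k x0| ≤ C) (b : Fin d) {x y : E d}
    (hx : ‖x‖ ≤ 1/2) (hy : ‖y‖ ≤ 1/2) : |v b x - v b y| ≤ d * C * ‖x - y‖ := by
  obtain ⟨Lv, hLv⟩ := D.vLip
  have hk : ∀ k, |cv (sc (rr k) φ) (v b) x - cv (sc (rr k) φ) (v b) y| ≤ d * C * ‖x - y‖ := by
    intro k
    have t := sc_tf (rr_pos k) hφ.tf
    have hsm := cv_smooth (t.pd b) D.uLoc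
    have hb : ∀ p ∈ closedBall (0 : E d) (1/2), ‖fderiv ℝ (cv (pd b (sc (rr k) φ)) u) p‖
        ≤ d * C := by
      intro p hp
      rw [mem_closedBall_zero_iff] at hp
      refine abs_fderiv_le.trans ?_
      have : ∀ a ∈ Finset.univ, |pd a (cv (pd b (sc (rr k) φ)) u) p| ≤ C := by
        intro a _
        rw [cv_pd (t.pd b) D.uLoc]
        exact hC a b p hp k
      refine (Finset.sum_le_card_nsmul _ _ _ this).trans ?_
      simp
    have := (convex_closedBall (0 : E d) (1/2)).norm_image_sub_le_of_norm_fderiv_le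
      (fun p _ => hsm.differentiable (by simp) p) hb
      (mem_closedBall_zero_iff.2 hy) (mem_closedBall_zero_iff.2 hx)
    rw [Real.norm_eq_abs, cv_first hφ b D k (by linarith), cv_first hφ b D k (by linarith)] at this
    exact this
  have hlim : ∀ z, Tendsto (fun k => cv (sc (rr k) φ) (v b) z) atTop (𝓝 (v b z)) := by
    intro z
    rw [tendsto_iff_dist_tendsto_zero]
    have h0 : Tendsto (fun k => (∫ z, |φ z|) * (Lv * rr k)) atTop (𝓝 0) := by
      have := (rr_tendsto.const_mul (Lv:ℝ)).const_mul (∫ z, |φ z|)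
      simpa using this
    exact squeeze_zero (fun k => dist_nonneg)
      (fun k => cv_lip_limit (rr_pos k) hφ h1 (hLv b) z) h0
  exact le_of_tendsto ((hlim x).sub (hlim y)).abs (Eventually.of_forall hk)

theorem lip_zero_set {d : ℕ} (i0 : Fin d) {w : E d → ℝ} {L : ℝ≥0} (hw : LipschitzWith L w) :
    ∀ᵐ x, w x = 0 → fderiv ℝ w x = 0 := by
  set s : Set (E d) := {x | w x = 0} ∩ {x | DifferentiableAt ℝ w x} with hs
  have hsm : MeasurableSet s :=
    (hw.continuous.measurable (measurableSet_singleton 0)).inter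
      (measurableSet_of_differentiableAt ℝ w)
  set F : E d → E d := fun x => w x • eb i0 with hF
  set F' : E d → E d →L[ℝ] E d := fun x => (fderiv ℝ w x).smulRight (eb i0) with hF'
  have happ : ApproximatesLinearOn F (0 : E d →L[ℝ] E d) s 0 := by
    intro x hx y hy
    have e1 : w x = 0 := hx.1
    have e2 : w y = 0 := hy.1
    simp [hF, e1, e2]
  have h := happ.norm_fderiv_sub_le volume hsm F' (fun x hx =>
    (hx.2.hasFDerivAt.smul_const (eb i0)).hasFDerivWithinAt)
  rw [ae_restrict_iff' hsm] at h
  filter_upwards [h, hw.ae_differentiableAt] with x hx hd h0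
  have := hx ⟨h0, hd⟩
  have h2 : F' x = 0 := by
    rw [sub_zero] at this
    exact nnnorm_eq_zero.1 (le_antisymm this zero_le)
  ext y
  have h3 := congrArg (fun T : E d →L[ℝ] E d => T y) h2
  simp only [hF', ContinuousLinearMap.smulRight_apply, zero_apply, smul_eq_zero] at h3
  rcases h3 with h3 | h3
  · simpa using h3
  · exfalso
    have := eb_norm i0
    rw [h3, norm_zero] at this
    exact zero_ne_one this

theorem holder_cont {d : ℕ} {f : E d → ℝ} {α K : ℝ} (hα : 0 < α)
    (h : ∀ x ∈ ball (0 : E d) 1, ∀ y ∈ ball (0 : E d) 1, |f x - f y| ≤ K * ‖x - y‖ ^ α) :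
    ContinuousOn f (ball (0 : E d) 1) := by
  intro x hx
  rw [ContinuousWithinAt, tendsto_iff_dist_tendsto_zero]
  have h0 : Tendsto (fun y : E d => K * ‖y - x‖ ^ α) (𝓝[ball 0 1] x) (𝓝 0) := by
    have hc : Continuous (fun y : E d => K * ‖y - x‖ ^ α) :=
      continuous_const.mul (Continuous.rpow_const (by fun_prop) fun _ => Or.inr hα.le)
    have := (hc.tendsto x).mono_left (nhdsWithin_le_nhds (s := ball 0 1))
    simpa [Real.zero_rpow hα.ne'] using this
  refine squeeze_zero' (Eventually.of_forall fun _ => dist_nonneg) ?_ h0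
  filter_upwards [self_mem_nhdsWithin] with y hy
  exact h y hy x hx

/-- extension of a C^{1,1} function on the ball and its gradient -/
theorem ext_c11 {d : ℕ} {u : E d → ℝ} {L : ℝ≥0} (hu : ContDiffOn ℝ 1 u (ball (0 : E d) 1))
    (hL : LipschitzOnWith L (fderiv ℝ u) (ball (0 : E d) 1)) :
    ∃ (ue : E d → ℝ) (v : Fin d → E d → ℝ), (∃ L', LipschitzWith L' ue) ∧
      (∀ j, LipschitzWith L (v j)) ∧ (∀ x ∈ ball (0 : E d) 1, ue x = u x) ∧
      (∀ x ∈ ball (0 : E d) 1, ∀ j, v j x = fderiv ℝ u x (eb j)) ∧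
      (∀ x ∈ ball (0 : E d) 1, ∀ j, pd j ue x = v j x) ∧
      (∀ x ∈ ball (0 : E d) 1, lap u x = gg v x) := by
  have h0 : (0 : E d) ∈ ball (0 : E d) 1 := by simp
  have hnb : ∀ x ∈ ball (0 : E d) 1, ball (0 : E d) 1 ∈ 𝓝 x := fun x hx => isOpen_ball.mem_nhds hx
  have hd : ∀ x ∈ ball (0 : E d) 1, DifferentiableAt ℝ u x := fun x hx =>
    (hu.differentiableOn (by simp)).differentiableAt (hnb x hx)
  have hul : LipschitzOnWith (‖fderiv ℝ u 0‖₊ + L) u (ball (0 : E d) 1) := by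
    refine (convex_ball (0 : E d) 1).lipschitzOnWith_of_nnnorm_fderiv_le hd fun x hx => ?_
    have h1 := hL.dist_le_mul x hx 0 h0
    rw [dist_eq_norm, dist_zero_right] at h1
    have h2 := norm_le_norm_add_norm_sub' (fderiv ℝ u x) (fderiv ℝ u 0)
    rw [mem_ball_zero_iff] at hx
    have h3 : (L:ℝ) * ‖x‖ ≤ L := mul_le_of_le_one_right L.2 hx.le
    rw [← NNReal.coe_le_coe]
    push_cast
    linarith
  obtain ⟨ue, hue, huee⟩ := hul.extend_real
  have hgl : ∀ j, LipschitzOnWith L (fun x => fderiv ℝ u x (eb j)) (ball (0 : E d) 1) := by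
    intro j
    refine LipschitzOnWith.of_dist_le_mul fun x hx y hy => ?_
    have h1 := hL.dist_le_mul x hx y hy
    rw [dist_eq_norm] at h1
    rw [Real.dist_eq]
    have h2 := (fderiv ℝ u x - fderiv ℝ u y).le_opNorm (eb j)
    rw [eb_norm, mul_one] at h2
    exact h2.trans h1
  choose v hv hve using fun j => (hgl j).extend_real
  refine ⟨ue, v, ⟨_, hue⟩, hv, fun x hx => (huee hx).symm, fun x hx j => (hve j hx).symm, ?_, ?_⟩
  · intro x hx j
    have : ue =ᶠ[𝓝 x] u := by
      filter_upwards [hnb x hx] with y hy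
      exact (huee hy).symm
    unfold pd
    rw [this.fderiv_eq]
    exact hve j hx
  · intro x hx
    unfold lap gg
    refine Finset.sum_congr rfl fun l _ => ?_
    have : v l =ᶠ[𝓝 x] fun y => fderiv ℝ u y (eb l) := by
      filter_upwards [hnb x hx] with y hy
      exact (hve l hy).symm
    unfold pd
    rw [this.fderiv_eq]

theorem make_dat {d : ℕ} (i0 : Fin d) {α K : ℝ} (hα : 0 < α) (hK : 0 ≤ K) {u ψ f : E d → ℝ}
    (hub : ∀ x ∈ ball (0 : E d) 1, |u x| ≤ K) (hfb : ∀ x ∈ ball (0 : E d) 1, |f x| ≤ K)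
    (hfH : ∀ x ∈ ball (0 : E d) 1, ∀ y ∈ ball (0 : E d) 1, |f x - f y| ≤ K * ‖x - y‖ ^ α)
    (hψ : ContDiffOn ℝ 1 ψ (ball (0 : E d) 1))
    (hψL : LipschitzOnWith (Real.toNNReal K) (fderiv ℝ ψ) (ball (0 : E d) 1))
    (hu : ContDiffOn ℝ 1 u (ball (0 : E d) 1)) {L : ℝ≥0}
    (huL : LipschitzOnWith L (fderiv ℝ u) (ball (0 : E d) 1))
    (hle : ∀ x ∈ ball (0 : E d) 1, u x ≤ ψ x)
    (heq : ∀ᵐ x : E d, x ∈ ball (0 : E d) 1 →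
        lap u x = (Om (ball (0 : E d) 1) u ∩ {y | u y < ψ y}).indicator f x
          + (Om (ball (0 : E d) 1) u ∩ {y | u y = ψ y}).indicator (lap ψ) x) :
    ∃ ue v f' Z, Dat ue v f' Z α K (K + d * K) ∧
      ∀ x ∈ ball (0 : E d) 1, ∀ j, v j x = fderiv ℝ u x (eb j) := by
  obtain ⟨ue, v, hue, hv, e1, e2, e3, e4⟩ := ext_c11 hu huL
  obtain ⟨ψe, p, hψe, hp, g1, g2, g3, g4⟩ := ext_c11 hψ hψL
  obtain ⟨L1, hL1⟩ := hue
  obtain ⟨L2, hL2⟩ := hψe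
  set Z : Set (E d) := ball 0 1 ∩ (({x | ue x = 0} ∩ ⋂ j, {x | v j x = 0}) ∪ {x | ue x = ψe x}) with hZ
  have hpb : ∀ i j x, |pd i (p j) x| ≤ K := by
    intro i j x
    have := lip_pd_bound (hp j) i x
    rwa [Real.coe_toNNReal K hK] at this
  refine ⟨ue, v, (ball 0 1).indicator f, Z, ?_, e2⟩
  refine ⟨⟨L1, hL1⟩, ⟨L, hv⟩, e3, ?_, ?_, ?_, ?_, ?_, ?_, ?_, ?_⟩
  · intro x hx; rw [e1 x hx]; exact hub x hx
  · rw [aestronglyMeasurable_indicator_iff measurableSet_ball]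
    exact (holder_cont hα hfH).aestronglyMeasurable measurableSet_ball
  · intro x
    by_cases hx : x ∈ ball (0 : E d) 1
    · rw [indicator_of_mem hx]; exact hfb x hx
    · rw [indicator_of_notMem hx, abs_zero]; exact hK
  · intro x hx y hy
    rw [indicator_of_mem hx, indicator_of_mem hy]; exact hfH x hx y hy
  · refine measurableSet_ball.inter (MeasurableSet.union (MeasurableSet.inter ?_ ?_) ?_)
    · exact hL1.continuous.measurable (measurableSet_singleton 0)
    · exact MeasurableSet.iInter fun j => (hv j).continuous.measurable (measurableSet_singleton 0)
    · exact measurableSet_eq_fun hL1.continuous.measurable hL2.continuous.measurable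
  · filter_upwards [heq] with x hx hb hnZ
    have hne : u x ≠ ψ x := by
      intro h
      exact hnZ ⟨hb, Or.inr (by simp only [mem_ofPred_eq]; rw [e1 x hb, g1 x hb, h])⟩
    have hlt : u x < ψ x := lt_of_le_of_ne (hle x hb) hne
    have hOm : x ∈ Om (ball (0 : E d) 1) u := by
      refine ⟨hb, fun hl => hnZ ⟨hb, Or.inl ⟨?_, ?_⟩⟩⟩
      · simp only [mem_ofPred_eq]; rw [e1 x hb]; exact hl.2.1
      · rw [mem_iInter]
        intro j
        have hg := hl.2.2
        unfold gradient at hg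
        have hg' : fderiv ℝ u x = 0 := by simpa using hg
        simp only [mem_ofPred_eq]
        rw [e2 x hb, hg']; simp
    rw [← e4 x hb, hx hb, indicator_of_mem hb, indicator_of_mem (show x ∈ Om (ball (0 : E d) 1) u ∩ {y | u y < ψ y} from ⟨hOm, hlt⟩),
      indicator_of_notMem (fun h => hne h.2), add_zero]
  · filter_upwards [heq] with x hx hb
    rw [← e4 x hb, hx hb]
    refine (abs_add_le _ _).trans (add_le_add ?_ ?_)
    · by_cases h : x ∈ Om (ball (0 : E d) 1) u ∩ {y | u y < ψ y}
      · rw [indicator_of_mem h]; exact hfb x hb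
      · rw [indicator_of_notMem h, abs_zero]; exact hK
    · by_cases h : x ∈ Om (ball (0 : E d) 1) u ∩ {y | u y = ψ y}
      · rw [indicator_of_mem h, g4 x hb]
        unfold gg
        refine (Finset.abs_sum_le_sum_abs _ _).trans ?_
        refine (Finset.sum_le_card_nsmul _ _ K fun l _ => hpb l l x).trans ?_
        simp
      · rw [indicator_of_notMem h, abs_zero]; positivity
  · have hz1 : ∀ᵐ x, ∀ j, v j x = 0 → fderiv ℝ (v j) x = 0 :=
      ae_all_iff.2 fun j => lip_zero_set i0 (hv j)
    have hz2 : ∀ᵐ x, ∀ j, v j x - p j x = 0 → fderiv ℝ (fun y => v j y - p j y) x = 0 :=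
      ae_all_iff.2 fun j => lip_zero_set i0 ((hv j).sub (hp j))
    have hd1 : ∀ᵐ x, ∀ j, DifferentiableAt ℝ (v j) x :=
      ae_all_iff.2 fun j => (hv j).ae_differentiableAt
    have hd2 : ∀ᵐ x, ∀ j, DifferentiableAt ℝ (p j) x :=
      ae_all_iff.2 fun j => (hp j).ae_differentiableAt
    filter_upwards [hz1, hz2, hd1, hd2] with x h1 h2 h3 h4 hb hZx i j
    rcases hZx.2 with h | h
    · have hvj : v j x = 0 := by have := mem_iInter.1 h.2 j; exact this
      unfold pd
      rw [h1 j hvj]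
      simpa using hK
    · have huψ : u x = ψ x := by rw [← e1 x hb, ← g1 x hb]; exact h
      have hnb := isOpen_ball.mem_nhds hb
      have du : DifferentiableAt ℝ u x :=
        (hu.differentiableOn (by simp)).differentiableAt hnb
      have dψ : DifferentiableAt ℝ ψ x :=
        (hψ.differentiableOn (by simp)).differentiableAt hnb
      have hmin : IsLocalMin (fun y => ψ y - u y) x := by
        filter_upwards [hnb] with y hy
        have := hle y hy
        simp only [huψ, sub_self]; linarith
      have hz := hmin.fderiv_eq_zero
      rw [fderiv_fun_sub dψ du] at hz
      have hgr : fderiv ℝ ψ x = fderiv ℝ u x := sub_eq_zero.1 hz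
      have h5 := h2 j (by rw [e2 x hb, g2 x hb, hgr, sub_self])
      rw [fderiv_fun_sub (h3 j) (h4 j)] at h5
      have h6 : fderiv ℝ (v j) x = fderiv ℝ (p j) x := sub_eq_zero.1 h5
      have := hpb i j x
      unfold pd at this ⊢
      rw [h6]; exact this


/-- **Optimal regularity.** There is `C > 0`, depending only on the dimension, `α`, and the
bound `K` on `‖u‖_{L^∞(B₁)}`, `‖f‖_{C^{0,α}(B₁)}`, `‖ψ‖_{C^{1,1}(B₁)}`, such that any
`C^{1,1}` solution `u` of `Δu = f·χ_{Ω(u)∩{u<ψ}} + Δψ·χ_{Ω(u)∩{u=ψ}}`, `u ≤ ψ` in `B₁`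
satisfies `‖D²u‖_{L^∞(B_{1/2})} ≤ C`. -/
theorem optimal_regularity (n : ℕ) (α K : ℝ) (hα : 0 < α) (hα1 : α ≤ 1) :
    ∃ C > 0, ∀ u ψ f : E (n + 2) → ℝ,
      (∀ x ∈ B1 (n + 2), |u x| ≤ K) →
      (∀ x ∈ B1 (n + 2), |f x| ≤ K) →
      (∀ x ∈ B1 (n + 2), ∀ y ∈ B1 (n + 2), |f x - f y| ≤ K * ‖x - y‖ ^ α) →
      (∀ x ∈ B1 (n + 2), |ψ x| ≤ K ∧ ‖fderiv ℝ ψ x‖ ≤ K) →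
      ContDiffOn ℝ 1 ψ (B1 (n + 2)) →
      LipschitzOnWith (Real.toNNReal K) (fderiv ℝ ψ) (B1 (n + 2)) →
      ContDiffOn ℝ 1 u (B1 (n + 2)) →
      (∃ K' : ℝ≥0, LipschitzOnWith K' (fderiv ℝ u) (B1 (n + 2))) →
      (∀ x ∈ B1 (n + 2), u x ≤ ψ x) →
      (∀ᵐ x : E (n + 2), x ∈ B1 (n + 2) →
        lap u x = (Om (B1 (n + 2)) u ∩ {y | u y < ψ y}).indicator f x
          + (Om (B1 (n + 2)) u ∩ {y | u y = ψ y}).indicator (lap ψ) x) →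
      LipschitzOnWith (Real.toNNReal C) (fderiv ℝ u) (ball (0 : E (n + 2)) (1 / 2)) := by
  rcases lt_or_ge K 0 with hK | hK
  · refine ⟨1, one_pos, fun u ψ f hub => ?_⟩
    have h := hub 0 (by simp [B1])
    exact absurd ((abs_nonneg _).trans h) (not_le.2 hK)
  have i0 : Fin (n + 2) := 0
  obtain ⟨φ, Φ, hφ, hΦ, h1, hlap⟩ := exists_kernels (n + 2) i0
  have hG : 0 ≤ K + ((n + 2 : ℕ) : ℝ) * K := by positivity
  choose c hc using fun a b => AA_bound (G := K + ((n + 2 : ℕ) : ℝ) * K) hφ hΦ h1 hlap a b hα hK hG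
  set C0 : ℝ := ∑ a, ∑ b, |c a b| with hC0
  have hC00 : 0 ≤ C0 := Finset.sum_nonneg fun a _ => Finset.sum_nonneg fun b _ => abs_nonneg _
  have hcC : ∀ a b, c a b ≤ C0 := by
    intro a b
    refine (le_abs_self _).trans ?_
    refine (Finset.single_le_sum (f := fun b => |c a b|) (fun b _ => abs_nonneg _)
      (Finset.mem_univ b)).trans ?_
    exact Finset.single_le_sum (f := fun a => ∑ b, |c a b|)
      (fun a _ => Finset.sum_nonneg fun b _ => abs_nonneg _) (Finset.mem_univ a)
  set d : ℕ := n + 2 with hd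
  have hCp : 0 < (d : ℝ) * ((d : ℝ) * C0) + 1 := by positivity
  refine ⟨(d : ℝ) * ((d : ℝ) * C0) + 1, hCp,
    fun u ψ f hub hfb hfH _ hψ hψL hu huL hle heq => ?_⟩
  obtain ⟨L, huL⟩ := huL
  obtain ⟨ue, v, f', Z, D, hv⟩ := make_dat i0 hα hK hub hfb hfH hψ hψL hu huL hle heq
  refine LipschitzOnWith.of_dist_le_mul fun x hx y hy => ?_
  rw [Real.coe_toNNReal _ hCp.le, dist_eq_norm, dist_eq_norm]
  have hx1 : x ∈ ball (0 : E d) 1 := ball_subset_ball (by norm_num) hx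
  have hy1 : y ∈ ball (0 : E d) 1 := ball_subset_ball (by norm_num) hy
  rw [mem_ball_zero_iff] at hx hy
  refine (clm_norm_le _).trans ?_
  have hb : ∀ j ∈ Finset.univ, |(fderiv ℝ u x - fderiv ℝ u y) (eb j)| ≤ d * C0 * ‖x - y‖ := by
    intro j _
    have h := v_lip hφ h1 D (C := C0)
      (fun a b x0 hx0 k => (hc a b ue v f' Z D x0 hx0 k).trans (hcC a b)) j hx.le hy.le
    rw [hv x hx1, hv y hy1] at h
    exact h
  refine (Finset.sum_le_card_nsmul _ _ _ hb).trans ?_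
  simp only [Finset.card_univ, Fintype.card_fin, nsmul_eq_mul]
  nlinarith [norm_nonneg (x - y)]
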